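/- Let R be a commutative noetherian ring with a dualizing module D, let p be a prime ideal of R of height h, and let M be any R-module. Then for every k ≥ 0 there is an isomorphism Tor_k^R(M, Hom_R(D, E(R/p))) ≅ H^{h−k}_{pR_p}(M_p), where H^{h−k}_{pR_p}(M_p) is the (h−k)-th local cohomology of the R_p-module M_p with respect to the maximal ideal pR_p (interpreted as 0 when k > h). -/

import Mathlib

open CategoryTheory

universe u

/-- The `a`-torsion submodule `Γ_a(M) = {x ∈ M | a^n x = 0 for some n}`. -/
def torsionGamma {R : Type u} [CommRing R] (a : Ideal R) (M : Type u)
    [AddCommGroup M] [Module R M] : Submodule R M :=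
  ⨆ n : ℕ, Submodule.torsionBySet R M ((a ^ n : Ideal R) : Set R)

/-- Data witnessing that `G` is Gorenstein injective: a ℤ-indexed exact complex of
injective modules, remaining exact after `Hom_R(E', -)` for every injective `E'`,
with `G ≅ ker(E_0 → E_{-1})`. -/
structure GorensteinInjData (R : Type u) [CommRing R] (G : Type u)
    [AddCommGroup G] [Module R G] where
  E : ℤ → Type u
  [acg : ∀ i, AddCommGroup (E i)]
  [mod : ∀ i, Module R (E i)]
  d : ∀ i : ℤ, E (i + 1) →ₗ[R] E i
  inj : ∀ i, Module.Injective R (E i)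
  exact : ∀ i : ℤ, LinearMap.range (d (i + 1)) = LinearMap.ker (d i)
  homExact : ∀ (E' : Type u) [AddCommGroup E'] [Module R E'], Module.Injective R E' →
      ∀ (i : ℤ) (g : E' →ₗ[R] E (i + 1)),
        (d i).comp g = 0 ↔ ∃ f : E' →ₗ[R] E (i + 1 + 1), (d (i + 1)).comp f = g
  equiv : G ≃ₗ[R] LinearMap.ker (d (-1))

/-- An `R`-module `G` is Gorenstein injective. -/
def IsGorensteinInjective (R : Type u) [CommRing R] (G : Type u)
    [AddCommGroup G] [Module R G] : Prop :=
  Nonempty (GorensteinInjData R G)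

/-- Data witnessing that `M` is Gorenstein flat. -/
structure GorensteinFlatData (R : Type u) [CommRing R] (M : Type u)
    [AddCommGroup M] [Module R M] where
  F : ℤ → Type u
  [acg : ∀ i, AddCommGroup (F i)]
  [mod : ∀ i, Module R (F i)]
  d : ∀ i : ℤ, F (i + 1) →ₗ[R] F i
  flat : ∀ i, Module.Flat R (F i)
  exact : ∀ i : ℤ, LinearMap.range (d (i + 1)) = LinearMap.ker (d i)
  tensorExact : ∀ (E' : Type u) [AddCommGroup E'] [Module R E'], Module.Injective R E' →
      ∀ i : ℤ, LinearMap.range (LinearMap.lTensor E' (d (i + 1)))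
        = LinearMap.ker (LinearMap.lTensor E' (d i))
  equiv : M ≃ₗ[R] LinearMap.ker (d (-1))

/-- An `R`-module `M` is Gorenstein flat. -/
def IsGorensteinFlat (R : Type u) [CommRing R] (M : Type u)
    [AddCommGroup M] [Module R M] : Prop :=
  Nonempty (GorensteinFlatData R M)

/-- `E` is an injective hull of `M`: `E` is injective and admits an injective
linear map from `M` with essential image. -/
def IsInjectiveHull (R : Type u) [CommRing R] (M : Type u) [AddCommGroup M] [Module R M]
    (E : Type u) [AddCommGroup E] [Module R E] : Prop :=
  Module.Injective R E ∧ ∃ f : M →ₗ[R] E, Function.Injective f ∧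
    ∀ N : Submodule R E, N ≠ ⊥ → N ⊓ LinearMap.range f ≠ ⊥

/-- `D` is a dualizing module for `R`: finitely generated, of finite injective dimension,
the homothety map `R → Hom_R(D,D)` is bijective, and `Ext^i_R(D,D) = 0` for `i ≥ 1`. -/
def IsDualizingModule (R : Type u) [CommRing R] (D : Type u)
    [AddCommGroup D] [Module R D] : Prop :=
  Module.Finite R D ∧
  (∃ n : ℕ, ∀ (M : Type u) (_ : AddCommGroup M) (_ : Module R M), ∀ i : ℕ, n < i →
      Limits.IsZero (((Ext R (ModuleCat.{u} R) i).obj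
        (Opposite.op (ModuleCat.of R M))).obj (ModuleCat.of R D))) ∧
  Function.Bijective (fun r : R => (r • (LinearMap.id : D →ₗ[R] D))) ∧
  (∀ i : ℕ, 0 < i →
    Limits.IsZero (((Ext R (ModuleCat.{u} R) i).obj
      (Opposite.op (ModuleCat.of R D))).obj (ModuleCat.of R D)))

/-- The height of a prime ideal, as the `Order.height` of the corresponding
point of the prime spectrum. -/
noncomputable def idealHeight {R : Type u} [CommRing R] (p : Ideal R) (hp : p.IsPrime) : ℕ∞ :=
  Order.height (⟨p, hp⟩ : PrimeSpectrum R)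
namespace TH
open CategoryTheory Limits Opposite

section cmp
variable {R : Type u} [CommRing R] {X X' : ModuleCat.{u} R}

noncomputable def lyMap {P Q : ChainComplex (ModuleCat.{u} R) ℕ} (φ : P ⟶ Q) (Y : ModuleCat.{u} R) :
    Q.linearYonedaObj R Y ⟶ P.linearYonedaObj R Y :=
  (HomologicalComplex.unopFunctor _ _).map
    ((((linearYoneda R (ModuleCat.{u} R)).obj Y).rightOp.mapHomologicalComplex _).map φ).op

lemma catAux {C : Type*} [Category* C] {a b c d e f : C} (x₁ : a ⟶ b) (x₂ : b ⟶ c) (x₃ : c ⟶ d)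
    (m : b ⟶ e) (q : e ⟶ d) (x : a ⟶ f) (y : f ⟶ e) (h : x₂ ≫ x₃ = m ≫ q) (h' : x₁ ≫ m = x ≫ y) :
    (x₁ ≫ x₂) ≫ x₃ = x ≫ y ≫ q := by
  rw [Category.assoc, h, reassoc_of% h']

lemma isoExt_nat (f : X ⟶ X') (P : ProjectiveResolution X) (Q : ProjectiveResolution X')
    (φ : ProjectiveResolution.Hom P Q f) (n : ℕ) (Y : ModuleCat.{u} R) :
    ((CategoryTheory.Functor.map (Ext R (ModuleCat.{u} R) n) f.op).app Y) ≫ (P.isoExt n Y).hom =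
      (Q.isoExt (R := R) n Y).hom ≫ HomologicalComplex.homologyMap (lyMap φ.hom Y) n := by
  have h := P.isoLeftDerivedObj_inv_naturality f Q φ.hom (by
      have := φ.hom_f_zero_comp_π_f_zero; simpa using this)
    ((linearYoneda R (ModuleCat.{u} R)).obj Y).rightOp n
  have h3 := HomologicalComplex.homologyOp_hom_naturality (lyMap φ.hom Y) n
  have h3 := (Iso.eq_comp_inv _).2 ((Category.assoc _ _ _).trans ((Iso.inv_comp_eq _).2 h3))
  apply Quiver.Hom.op_inj
  exact catAux (C := (ModuleCat.{u} R)ᵒᵖ) _ _ _ _ _ _ _ h h3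

lemma ly_d_apply (P : ChainComplex (ModuleCat.{u} R) ℕ) (Y : ModuleCat.{u} R) (i j : ℕ)
    (f : P.X i ⟶ Y) : ((P.linearYonedaObj R Y).d i j).hom f = P.d j i ≫ f := rfl

lemma lyMap_apply {P Q : ChainComplex (ModuleCat.{u} R) ℕ} (φ : P ⟶ Q) (Y : ModuleCat.{u} R) (i : ℕ)
    (f : Q.X i ⟶ Y) : ((lyMap φ Y).f i).hom f = φ.f i ≫ f := rfl

noncomputable def cyc (P : ChainComplex (ModuleCat.{u} R) ℕ) (Y : ModuleCat.{u} R) (n : ℕ)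
    (z : (P.linearYonedaObj R Y).cycles n) : P.X n ⟶ Y :=
  ((P.linearYonedaObj R Y).iCycles n).hom z

lemma cyc_d (P : ChainComplex (ModuleCat.{u} R) ℕ) (Y : ModuleCat.{u} R) (n : ℕ)
    (z : (P.linearYonedaObj R Y).cycles n) : P.d (n+1) n ≫ cyc P Y n z = 0 := by
  have := (P.linearYonedaObj R Y).iCycles_d n (n+1)
  have := congrArg (fun t => t.hom z) this
  exact this

lemma smul_extMk (P : ProjectiveResolution X) {Y : ModuleCat.{u} R} {n : ℕ} (r : R)
    (f : P.complex.X n ⟶ Y) (m : ℕ) (hm : n + 1 = m) (hf : P.complex.d m n ≫ f = 0) :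
    P.extMk (r • f) m hm (by rw [Linear.comp_smul, hf, smul_zero]) = r • P.extMk f m hm hf := by
  rw [Abelian.Ext.smul_eq_comp_mk₀, P.extMk_comp_mk₀]
  congr 1

noncomputable def cycToExt (P : ProjectiveResolution X) (Y : ModuleCat.{u} R) (n : ℕ) :
    (P.complex.linearYonedaObj R Y).cycles n →ₗ[R] Abelian.Ext X Y n where
  toFun z := P.extMk (cyc _ _ _ z) (n+1) rfl (cyc_d _ _ _ z)
  map_add' x y := by
    rw [P.add_extMk]
    congr 1
    exact map_add ((P.complex.linearYonedaObj R Y).iCycles n).hom x y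
  map_smul' r x := by
    dsimp
    rw [← smul_extMk]
    congr 1
    exact map_smul ((P.complex.linearYonedaObj R Y).iCycles n).hom r x

lemma cycToExt_surj (P : ProjectiveResolution X) (Y : ModuleCat.{u} R) (n : ℕ) :
    Function.Surjective (cycToExt P Y n) := by
  intro α
  obtain ⟨f, hf, rfl⟩ := P.extMk_surjective α (n+1) rfl
  let K := P.complex.linearYonedaObj R Y
  have h1 := (ShortComplex.moduleCat_exact_iff _).1
    (ShortComplex.exact_of_f_is_kernel (ShortComplex.mk _ _ (K.iCycles_d n (n+1))) (K.cyclesIsKernel n (n+1) (by simp)))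
  obtain ⟨z, hz⟩ := h1 f hf
  refine ⟨z, ?_⟩
  change P.extMk (cyc _ _ _ z) (n+1) rfl (cyc_d _ _ _ z) = _
  congr 1

lemma cycToExt_ker (P : ProjectiveResolution X) (Y : ModuleCat.{u} R) (n : ℕ)
    (z : (P.complex.linearYonedaObj R Y).cycles n) :
    cycToExt P Y n z = 0 ↔ ((P.complex.linearYonedaObj R Y).homologyπ n).hom z = 0 := by
  let K := P.complex.linearYonedaObj R Y
  change P.extMk (cyc _ _ _ z) (n+1) rfl (cyc_d _ _ _ z) = 0 ↔ (K.homologyπ n).hom z = 0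
  have hinj : Function.Injective (K.iCycles n).hom :=
    (ModuleCat.mono_iff_injective _).1 inferInstance
  rcases n with _ | p
  · have h0 : IsIso (K.homologyπ 0) := K.isIso_homologyπ _ 0 rfl (K.shape _ _ (by simp))
    have hbij : Function.Injective (K.homologyπ 0).hom :=
      (ModuleCat.mono_iff_injective _).1 inferInstance
    constructor
    · intro h
      suffices z = 0 by rw [this, map_zero]
      apply hinj
      rw [map_zero]
      change cyc _ _ _ z = 0
      rw [← P.extEquivCohomologyClass.apply_eq_iff_eq,
        P.extEquivCohomologyClass_extMk, P.extEquivCohomologyClass_zero,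
        CochainComplex.HomComplex.CohomologyClass.mk_eq_zero_iff,
        CochainComplex.HomComplex.Cocycle.toSingleMk_mem_coboundaries_iff _ _ _ _ _ 1 (by simp)] at h
      obtain ⟨g, hg⟩ := h
      have hz : IsZero (P.cochainComplex.X 1) := P.cochainComplex.isZero_of_isStrictlyLE 0 1
      rw [hz.eq_of_src g 0, comp_zero] at hg
      have hi := (P.cochainComplexXIso (-((0 : ℕ) : ℤ)) 0 rfl)
      rw [← cancel_epi (P.cochainComplexXIso (-((0 : ℕ) : ℤ)) 0 rfl).hom, comp_zero]
      exact hg.symm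
    · intro h
      have : z = 0 := hbij (by rw [h, map_zero])
      subst this
      rw [← P.extMk_zero 1 rfl]
      congr 1
      exact map_zero (K.iCycles 0).hom
  · rw [P.extMk_eq_zero_iff _ _ _ _ p rfl]
    have h1 := (ShortComplex.moduleCat_exact_iff _).1
      (ShortComplex.exact_of_g_is_cokernel
      (ShortComplex.mk _ _ (K.toCycles_comp_homologyπ p (p+1))) (K.homologyIsCokernel p (p+1) (by simp)))
    constructor
    · rintro ⟨g, hg⟩
      have : z = (K.toCycles p (p+1)).hom g := by
        apply hinj
        refine Eq.trans hg.symm ?_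
        exact (congrArg (fun t => t.hom g) (K.toCycles_i p (p+1))).symm
      rw [this]
      exact (congrArg (fun t => t.hom g) (K.toCycles_comp_homologyπ p (p+1)))
    · intro h
      obtain ⟨g, hg⟩ := h1 z h
      refine ⟨g, ?_⟩
      change _ = (K.iCycles (p+1)).hom z
      rw [← hg]
      exact (congrArg (fun t => t.hom g) (K.toCycles_i p (p+1))).symm

noncomputable def homToExt (P : ProjectiveResolution X) (Y : ModuleCat.{u} R) (n : ℕ) :
    (P.complex.linearYonedaObj R Y).homology n ≃ₗ[R] Abelian.Ext X Y n :=
  (LinearMap.quotKerEquivOfSurjective ((P.complex.linearYonedaObj R Y).homologyπ n).hom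
    ((ModuleCat.epi_iff_surjective _).1 inferInstance)).symm ≪≫ₗ
  (Submodule.quotEquivOfEq _ _ (by ext z; simpa using (cycToExt_ker P Y n z).symm)) ≪≫ₗ
  LinearMap.quotKerEquivOfSurjective (cycToExt P Y n) (cycToExt_surj P Y n)

lemma homToExt_π (P : ProjectiveResolution X) (Y : ModuleCat.{u} R) (n : ℕ)
    (z : (P.complex.linearYonedaObj R Y).cycles n) :
    homToExt P Y n (((P.complex.linearYonedaObj R Y).homologyπ n).hom z) = cycToExt P Y n z := by
  have : (LinearMap.quotKerEquivOfSurjective ((P.complex.linearYonedaObj R Y).homologyπ n).hom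
    ((ModuleCat.epi_iff_surjective _).1 inferInstance)).symm
      (((P.complex.linearYonedaObj R Y).homologyπ n).hom z) = Submodule.Quotient.mk z := by
    rw [LinearEquiv.symm_apply_eq]; rfl
  unfold homToExt
  rw [LinearEquiv.trans_apply, LinearEquiv.trans_apply, this]
  rfl

lemma homToExt_nat (f : X ⟶ X') (P : ProjectiveResolution X) (Q : ProjectiveResolution X')
    (φ : ProjectiveResolution.Hom P Q f) (n : ℕ) (Y : ModuleCat.{u} R)
    (x : (Q.complex.linearYonedaObj R Y).homology n) :
    homToExt P Y n ((HomologicalComplex.homologyMap (lyMap φ.hom Y) n).hom x) =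
      (Abelian.Ext.mk₀ f).comp (homToExt Q Y n x) (zero_add n) := by
  obtain ⟨z, rfl⟩ := (ModuleCat.epi_iff_surjective
    ((Q.complex.linearYonedaObj R Y).homologyπ n)).1 inferInstance x
  have h1 := congrArg (fun t => t.hom z)
    (HomologicalComplex.homologyπ_naturality (lyMap φ.hom Y) n)
  refine (congrArg (homToExt P Y n) h1).trans ?_
  refine (homToExt_π P Y n _).trans ?_
  refine Eq.trans ?_ (congrArg (fun t => (Abelian.Ext.mk₀ f).comp t (zero_add n))
    (homToExt_π Q Y n z)).symm
  refine Eq.trans ?_ (ProjectiveResolution.mk₀_comp_extMk _ _ rfl (cyc_d _ _ _ z) φ).symm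
  change P.extMk (cyc _ _ _ _) _ rfl (cyc_d _ _ _ _) = _
  congr 1
  exact (congrArg (fun t => t.hom z)
    (HomologicalComplex.cyclesMap_i (lyMap φ.hom Y) n))

noncomputable def oldNew (X Y : ModuleCat.{u} R) (n : ℕ) :
    ((Ext R (ModuleCat.{u} R) n).obj (op X)).obj Y ≃ₗ[R] Abelian.Ext X Y n :=
  ((projectiveResolution X).isoExt n Y).toLinearEquiv ≪≫ₗ homToExt (projectiveResolution X) Y n

lemma oldNew_nat (f : X ⟶ X') (Y : ModuleCat.{u} R) (n : ℕ)
    (x : ((Ext R (ModuleCat.{u} R) n).obj (op X')).obj Y) :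
    oldNew X Y n (((CategoryTheory.Functor.map (Ext R (ModuleCat.{u} R) n) f.op).app Y).hom x) =
      (Abelian.Ext.mk₀ f).comp (oldNew X' Y n x) (zero_add n) := by
  let P := projectiveResolution X
  let Q := projectiveResolution X'
  let φ : ProjectiveResolution.Hom P Q f := ⟨ProjectiveResolution.lift f P Q, by
    have := ProjectiveResolution.lift_commutes_zero f P Q
    simpa using this⟩
  have h := congrArg (fun t => t.hom x) (isoExt_nat f P Q φ n Y)
  refine (congrArg (homToExt P Y n) h).trans ?_
  exact homToExt_nat f P Q φ n Y _

lemma subsingleton_of_isZero {X Y : ModuleCat.{u} R} {n : ℕ}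
    (h : IsZero (((Ext R (ModuleCat.{u} R) n).obj (op X)).obj Y)) :
    Subsingleton (Abelian.Ext X Y n) :=
  have := ModuleCat.subsingleton_of_isZero h
  (oldNew X Y n).symm.injective.subsingleton

end cmp

section F
variable {S : Type u} [CommRing S] (m : Ideal S)

/-- the module `S / m ^ t` -/
abbrev Sm (t : ℕ) : ModuleCat.{u} S := ModuleCat.of S (S ⧸ m ^ t)

def qm {s t : ℕ} (h : s ≤ t) : Sm m t ⟶ Sm m s :=
  ModuleCat.ofHom (Submodule.mapQ _ _ LinearMap.id (Ideal.pow_le_pow_right h))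

lemma qm_id (s : ℕ) : qm m (le_refl s) = 𝟙 _ := by
  apply ModuleCat.hom_ext
  apply LinearMap.ext
  intro x; obtain ⟨x, rfl⟩ := Submodule.Quotient.mk_surjective _ x; rfl

lemma qm_comp {r s t : ℕ} (h : r ≤ s) (h' : s ≤ t) : qm m h' ≫ qm m h = qm m (h.trans h') := by
  apply ModuleCat.hom_ext
  apply LinearMap.ext
  intro x; obtain ⟨x, rfl⟩ := Submodule.Quotient.mk_surjective _ x; rfl

noncomputable abbrev tr (X : ModuleCat.{u} S) (i : ℕ) (s t : ℕ) (h : s ≤ t) :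
    Abelian.Ext (Sm m s) X i →ₗ[S] Abelian.Ext (Sm m t) X i :=
  Abelian.Ext.precompOfLinear (Abelian.Ext.mk₀ (qm m h)) S X (zero_add i)

lemma tr_apply (X : ModuleCat.{u} S) (i : ℕ) (s t : ℕ) (h : s ≤ t)
    (x : Abelian.Ext (Sm m s) X i) :
    tr m X i s t h x = (Abelian.Ext.mk₀ (qm m h)).comp x (zero_add i) := rfl

instance (X : ModuleCat.{u} S) (i : ℕ) :
    DirectedSystem (fun t : ℕ => Abelian.Ext (Sm m t) X i) (fun s t h => tr m X i s t h) where
  map_self s x := by rw [tr_apply, qm_id, Abelian.Ext.mk₀_id_comp]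
  map_map r s t h h' x := by
    rw [tr_apply, tr_apply, tr_apply, Abelian.Ext.mk₀_comp_mk₀_assoc, qm_comp]

/-- local cohomology as a direct limit of Ext modules -/
def F (i : ℕ) (X : ModuleCat.{u} S) : Type u :=
  Module.DirectLimit (fun t : ℕ => Abelian.Ext (Sm m t) X i) (fun s t h => tr m X i s t h)

noncomputable instance (i : ℕ) (X : ModuleCat.{u} S) : AddCommGroup (F m i X) :=
  Module.DirectLimit.addCommGroup _ _
noncomputable instance (i : ℕ) (X : ModuleCat.{u} S) : Module S (F m i X) :=
  Module.DirectLimit.module _ _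

noncomputable def F.of (i : ℕ) (X : ModuleCat.{u} S) (t : ℕ) :
    Abelian.Ext (Sm m t) X i →ₗ[S] F m i X :=
  Module.DirectLimit.of S ℕ (fun t : ℕ => Abelian.Ext (Sm m t) X i) (fun s t h => tr m X i s t h) t

variable {m}
lemma F.of_tr {i : ℕ} {X : ModuleCat.{u} S} {s t : ℕ} (h : s ≤ t)
    (x : Abelian.Ext (Sm m s) X i) : F.of m i X t ((Abelian.Ext.mk₀ (qm m h)).comp x (zero_add i)) =
      F.of m i X s x :=
  Module.DirectLimit.of_f (G := (fun t : ℕ => Abelian.Ext (Sm m t) X i))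
    (f := (fun s t h => tr m X i s t h)) (hij := h)

lemma F.exists_of {i : ℕ} {X : ModuleCat.{u} S} (z : F m i X) :
    ∃ t x, F.of m i X t x = z := 
  Module.DirectLimit.exists_of (G := (fun t : ℕ => Abelian.Ext (Sm m t) X i))
    (f := (fun s t h => tr m X i s t h)) z

lemma F.exists_of_ge {i : ℕ} {X : ModuleCat.{u} S} (z : F m i X) (s : ℕ) :
    ∃ t, s ≤ t ∧ ∃ x, F.of m i X t x = z := by
  obtain ⟨t, x, rfl⟩ := F.exists_of z
  exact ⟨max s t, le_max_left _ _, _, F.of_tr (le_max_right s t) x⟩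

lemma F.of_eq_zero {i : ℕ} {X : ModuleCat.{u} S} {t : ℕ} {x : Abelian.Ext (Sm m t) X i} :
    F.of m i X t x = 0 ↔
      ∃ s, ∃ h : t ≤ s, (Abelian.Ext.mk₀ (qm m h)).comp x (zero_add i) = 0 := by
  constructor
  · intro h
    obtain ⟨s, h, h'⟩ := 
      Module.DirectLimit.of.zero_exact (G := (fun t : ℕ => Abelian.Ext (Sm m t) X i))
        (f := (fun s t h => tr m X i s t h)) h
    exact ⟨s, h, h'⟩
  · rintro ⟨s, h, h'⟩
    rw [← F.of_tr h, h', map_zero]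

noncomputable def F.lift {i : ℕ} {X : ModuleCat.{u} S} {P : Type*} [AddCommGroup P] [Module S P]
    (g : ∀ t, Abelian.Ext (Sm m t) X i →ₗ[S] P)
    (hg : ∀ s t (h : s ≤ t) x, g t ((Abelian.Ext.mk₀ (qm m h)).comp x (zero_add i)) = g s x) :
    F m i X →ₗ[S] P := 
  Module.DirectLimit.lift S ℕ (fun t : ℕ => Abelian.Ext (Sm m t) X i)
    (fun s t h => tr m X i s t h) g hg

@[simp]
lemma F.lift_of {i : ℕ} {X : ModuleCat.{u} S} {P : Type*} [AddCommGroup P] [Module S P]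
    (g : ∀ t, Abelian.Ext (Sm m t) X i →ₗ[S] P)
    (hg : ∀ s t (h : s ≤ t) x, g t ((Abelian.Ext.mk₀ (qm m h)).comp x (zero_add i)) = g s x)
    (t : ℕ) (x) : F.lift g hg (F.of m i X t x) = g t x := 
  Module.DirectLimit.lift_of (G := (fun t : ℕ => Abelian.Ext (Sm m t) X i))
    (f := (fun s t h => tr m X i s t h)) g hg x

variable (m)

noncomputable def lcDiag (i : ℕ) (X : ModuleCat.{u} S) : (ℕᵒᵖ)ᵒᵖ ⥤ ModuleCat.{u} S :=
  localCohomology.diagram (localCohomology.idealPowersDiagram m) i ⋙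
    (evaluation (ModuleCat.{u} S) (ModuleCat.{u} S)).obj X

noncomputable def lcCocone (i : ℕ) (X : ModuleCat.{u} S) : Cocone (lcDiag m i X) where
  pt := ModuleCat.of S (F m i X)
  ι :=
    { app := fun t => ModuleCat.ofHom ((F.of m i X (unop (unop t))) ∘ₗ
        (oldNew (Sm m (unop (unop t))) X i).toLinearMap)
      naturality := fun s t f => by
        ext x
        have h := oldNew_nat (qm m f.unop.unop.le) X i x
        refine (congrArg (F.of m i X _) h).trans ?_
        exact F.of_tr _ _ }

noncomputable def lcDesc (i : ℕ) (X : ModuleCat.{u} S) (c : Cocone (lcDiag m i X)) :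
    F m i X →ₗ[S] c.pt :=
  F.lift (fun t => (c.ι.app (op (op t))).hom ∘ₗ
      (oldNew (Sm m t) X i).symm.toLinearMap) (by
        intro s t h x
        obtain ⟨y, rfl⟩ := (oldNew (Sm m s) X i).surjective x
        have h1 := oldNew_nat (qm m h) X i y
        have h2 := congrArg (fun f => f.hom y)
          (c.w (j' := op (op s)) (j := op (op t)) (homOfLE h).op.op)
        refine (congrArg (fun z => (c.ι.app (op (op t))).hom ((oldNew (Sm m t) X i).symm z))
          h1.symm).trans ?_
        refine (congrArg (c.ι.app (op (op t))).hom (LinearEquiv.symm_apply_apply _ _)).trans ?_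
        refine Eq.trans ?_ (congrArg (c.ι.app (op (op s))).hom
          (LinearEquiv.symm_apply_apply (oldNew (Sm m s) X i) y)).symm
        exact h2)

lemma lcDesc_of (i : ℕ) (X : ModuleCat.{u} S) (c : Cocone (lcDiag m i X)) (t : ℕ) 
    (y : ((Ext S (ModuleCat S) i).obj (op (Sm m t))).obj X) :
    lcDesc m i X c (F.of m i X t (oldNew (Sm m t) X i y)) = (c.ι.app (op (op t))).hom y := by
  refine (F.lift_of _ _ _ _).trans ?_
  exact congrArg (c.ι.app (op (op t))).hom
      (LinearEquiv.symm_apply_apply (oldNew (Sm m t) X i) y)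

noncomputable def lcColim (i : ℕ) (X : ModuleCat.{u} S) : IsColimit (lcCocone m i X) where
  desc c := ModuleCat.ofHom (lcDesc m i X c)
  fac c t := by
    ext x
    exact lcDesc_of m i X c _ _
  uniq c f hf := by
    ext z
    obtain ⟨t, x, rfl⟩ := F.exists_of z
    obtain ⟨y, rfl⟩ := (oldNew (Sm m t) X i).surjective x
    refine Eq.trans ?_ (lcDesc_of m i X c t y).symm
    exact congrArg (fun f => f.hom y) (hf (op (op t)))

noncomputable def lcIso (i : ℕ) (X : ModuleCat.{u} S) :
    (localCohomology m i).obj X ≅ ModuleCat.of S (F m i X) :=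
  (colimitObjIsoColimitCompEvaluation _ X) ≪≫ (colimit.isColimit (lcDiag m i X)).coconePointUniqueUpToIso
    (lcColim m i X)

end F
attribute [irreducible] F
end TH
namespace TH
open CategoryTheory Limits Opposite Abelian
section act
variable {S : Type u} [CommRing S] (m : Ideal S)

noncomputable def F.act {X Y : ModuleCat.{u} S} {i j k : ℕ} (α : Ext X Y j) (h : i + j = k) :
    F m i X →ₗ[S] F m k Y :=
  F.lift (fun t => F.of m k Y t ∘ₗ Ext.postcompOfLinear α S (Sm m t) h) (by
    intro s t hst x
    change F.of m k Y t (((Ext.mk₀ (qm m hst)).comp x _).comp α h) = F.of m k Y s (x.comp α h)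
    rw [← F.of_tr hst]
    congr 1
    rw [Ext.comp_assoc]
    omega)

variable {m}
lemma F.act_of {X Y : ModuleCat.{u} S} {i j k : ℕ} (α : Ext X Y j) (h : i + j = k) (t : ℕ)
    (x : Ext (Sm m t) X i) : F.act m α h (F.of m i X t x) = F.of m k Y t (x.comp α h) :=
  F.lift_of _ _ _ _

lemma F.act_comp {X Y Z : ModuleCat.{u} S} {i j k l n r : ℕ} (α : Ext X Y j) (β : Ext Y Z l)
    (h : i + j = k) (h' : k + l = n) (hr : j + l = r) (z : F m i X) :
    F.act m β h' (F.act m α h z) = F.act m (α.comp β hr) (by omega) z := by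
  obtain ⟨t, x, rfl⟩ := F.exists_of z
  rw [F.act_of, F.act_of, F.act_of, Ext.comp_assoc]
  omega

lemma F.act_add {X Y : ModuleCat.{u} S} {i j k : ℕ} (α β : Ext X Y j) (h : i + j = k) (z : F m i X) :
    F.act m (α + β) h z = F.act m α h z + F.act m β h z := by
  obtain ⟨t, x, rfl⟩ := F.exists_of z
  simp only [F.act_of, Ext.comp_add, map_add]

lemma F.act_smul {X Y : ModuleCat.{u} S} {i j k : ℕ} (r : S) (α : Ext X Y j) (h : i + j = k)
    (z : F m i X) : F.act m (r • α) h z = r • F.act m α h z := by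
  obtain ⟨t, x, rfl⟩ := F.exists_of z
  simp only [F.act_of, Ext.comp_smul, map_smul]

lemma F.act_zero {X Y : ModuleCat.{u} S} {i j k : ℕ} (h : i + j = k)
    (z : F m i X) : F.act m (0 : Ext X Y j) h z = 0 := by
  obtain ⟨t, x, rfl⟩ := F.exists_of z
  simp only [F.act_of, Ext.comp_zero, map_zero]

variable (m)
noncomputable def F.map (i : ℕ) {X Y : ModuleCat.{u} S} (f : X ⟶ Y) : F m i X →ₗ[S] F m i Y :=
  F.act m (Ext.mk₀ f) (add_zero i)
variable {m}

lemma F.map_of {i : ℕ} {X Y : ModuleCat.{u} S} (f : X ⟶ Y) (t : ℕ) (x : Ext (Sm m t) X i) :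
    F.map m i f (F.of m i X t x) = F.of m i Y t (x.comp (Ext.mk₀ f) (add_zero i)) := F.act_of _ _ _ _

lemma F.map_comp {i : ℕ} {X Y Z : ModuleCat.{u} S} (f : X ⟶ Y) (g : Y ⟶ Z) (z : F m i X) :
    F.map m i (f ≫ g) z = F.map m i g (F.map m i f z) := by
  unfold F.map
  rw [F.act_comp _ _ _ _ (add_zero 0), Ext.mk₀_comp_mk₀]

lemma F.map_id {i : ℕ} {X : ModuleCat.{u} S} (z : F m i X) :
    F.map m i (𝟙 X) z = z := by
  obtain ⟨t, x, rfl⟩ := F.exists_of z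
  rw [F.map_of, Ext.comp_mk₀_id]

lemma F.map_zero {i : ℕ} {X Y : ModuleCat.{u} S} (z : F m i X) :
    F.map m i (0 : X ⟶ Y) z = 0 := by
  unfold F.map
  rw [Ext.mk₀_zero, F.act_zero]

lemma F.map_add {i : ℕ} {X Y : ModuleCat.{u} S} (f g : X ⟶ Y) (z : F m i X) :
    F.map m i (f + g) z = F.map m i f z + F.map m i g z := by
  unfold F.map
  rw [Ext.mk₀_add, F.act_add]

lemma F.map_smul {i : ℕ} {X Y : ModuleCat.{u} S} (r : S) (f : X ⟶ Y) (z : F m i X) :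
    F.map m i (r • f) z = r • F.map m i f z := by
  unfold F.map
  rw [Ext.mk₀_smul, F.act_smul]

lemma F.map_sum {i : ℕ} {X Y : ModuleCat.{u} S} {ι : Type*} (s : Finset ι) (f : ι → (X ⟶ Y))
    (z : F m i X) : F.map m i (∑ j ∈ s, f j) z = ∑ j ∈ s, F.map m i (f j) z := by
  classical
  induction s using Finset.induction_on with
  | empty => simp [F.map_zero]
  | insert a s ha ih => rw [Finset.sum_insert ha, Finset.sum_insert ha, F.map_add, ih]

section LES
variable {T : ShortComplex (ModuleCat.{u} S)} (hT : T.ShortExact)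

variable (m) in
noncomputable def F.del (i : ℕ) : F m i T.X₃ →ₗ[S] F m (i+1) T.X₁ := F.act m hT.extClass rfl

lemma F.exact₂' {i : ℕ} (z : F m i T.X₁) : F.map m i T.g (F.map m i T.f z) = 0 := by
  rw [← F.map_comp, T.zero, F.map_zero]

lemma F.exact₃' {i : ℕ} (z : F m i T.X₂) : F.del m hT i (F.map m i T.g z) = 0 := by
  unfold F.map F.del
  rw [F.act_comp _ _ _ _ (zero_add 1), ShortComplex.ShortExact.comp_extClass, F.act_zero]

lemma F.exact₁' {i : ℕ} (z : F m i T.X₃) : F.map m (i+1) T.f (F.del m hT i z) = 0 := by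
  unfold F.map F.del
  rw [F.act_comp _ _ _ _ (add_zero 1), ShortComplex.ShortExact.extClass_comp, F.act_zero]

include hT in
lemma F.exact₂ {i : ℕ} {z : F m i T.X₂} (hz : F.map m i T.g z = 0) :
    ∃ w, F.map m i T.f w = z := by
  obtain ⟨t, x, rfl⟩ := F.exists_of z
  rw [F.map_of, F.of_eq_zero] at hz
  obtain ⟨s, h, hx⟩ := hz
  rw [← Ext.comp_assoc _ _ _ (zero_add i) _ (by omega)] at hx
  obtain ⟨y, hy⟩ := Ext.covariant_sequence_exact₂ _ hT _ hx
  exact ⟨F.of m i _ s y, by rw [F.map_of, hy, F.of_tr]⟩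

lemma F.exact₃ {i : ℕ} {z : F m i T.X₃} (hz : F.del m hT i z = 0) :
    ∃ w, F.map m i T.g w = z := by
  obtain ⟨t, x, rfl⟩ := F.exists_of z
  unfold F.del at hz
  rw [F.act_of, F.of_eq_zero] at hz
  obtain ⟨s, h, hx⟩ := hz
  rw [← Ext.comp_assoc _ _ _ (zero_add i) _ (by omega)] at hx
  obtain ⟨y, hy⟩ := Ext.covariant_sequence_exact₃ _ hT _ _ hx
  exact ⟨F.of m i _ s y, by rw [F.map_of, hy, F.of_tr]⟩

lemma F.exact₁ {i : ℕ} {z : F m (i+1) T.X₁} (hz : F.map m (i+1) T.f z = 0) :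
    ∃ w, F.del m hT i w = z := by
  obtain ⟨t, x, rfl⟩ := F.exists_of z
  rw [F.map_of, F.of_eq_zero] at hz
  obtain ⟨s, h, hx⟩ := hz
  rw [← Ext.comp_assoc _ _ _ (zero_add _) _ (by omega)] at hx
  obtain ⟨y, hy⟩ := Ext.covariant_sequence_exact₁ _ hT _ hx rfl
  exact ⟨F.of m i _ s y, by unfold F.del; rw [F.act_of, hy, F.of_tr]⟩

lemma F.map_inj_zero {X Y : ModuleCat.{u} S} (f : X ⟶ Y) [Mono f] :
    Function.Injective (F.map m 0 f) := by
  rw [injective_iff_map_eq_zero]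
  intro z hz
  obtain ⟨t, x, rfl⟩ := F.exists_of z
  rw [F.map_of, F.of_eq_zero] at hz
  obtain ⟨s, h, hx⟩ := hz
  rw [← Ext.comp_assoc _ _ _ (zero_add _) _ (by omega)] at hx
  rw [F.of_eq_zero]
  refine ⟨s, h, Ext.postcomp_mk₀_injective_of_mono _ f ?_⟩
  rw [_root_.map_zero]; exact hx

lemma F.map_inj_of {i : ℕ} (hT : T.ShortExact) (h : Subsingleton (F m i T.X₃)) :
    Function.Injective (F.map m (i+1) T.f) := by
  rw [injective_iff_map_eq_zero]
  intro z hz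
  obtain ⟨w, rfl⟩ := F.exact₁ hT hz
  rw [Subsingleton.elim w 0, _root_.map_zero]

lemma F.map_surj_of {i : ℕ} (hT : T.ShortExact) (h : Subsingleton (F m (i+1) T.X₁)) :
    Function.Surjective (F.map m i T.g) := fun _ => F.exact₃ hT (Subsingleton.elim _ _)

lemma F.del_inj_of {i : ℕ} (h : Subsingleton (F m i T.X₂)) :
    Function.Injective (F.del m hT i) := by
  rw [injective_iff_map_eq_zero]
  intro z hz
  obtain ⟨w, rfl⟩ := F.exact₃ hT hz
  rw [Subsingleton.elim w 0, _root_.map_zero]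

lemma F.del_surj_of {i : ℕ} (h : Subsingleton (F m (i+1) T.X₂)) :
    Function.Surjective (F.del m hT i) := fun _ => F.exact₁ hT (Subsingleton.elim _ _)

include hT in
lemma F.ss₂ {i : ℕ} (h₁ : Subsingleton (F m i T.X₁)) (h₃ : Subsingleton (F m i T.X₃)) :
    Subsingleton (F m i T.X₂) := by
  refine subsingleton_of_forall_eq 0 fun z => ?_
  obtain ⟨w, rfl⟩ := F.exact₂ hT (z := z) (Subsingleton.elim _ _)
  rw [Subsingleton.elim w 0, _root_.map_zero]

include hT in
lemma F.ss₁ {i : ℕ} (h₁ : Subsingleton (F m i T.X₃)) (h₃ : Subsingleton (F m (i+1) T.X₂)) :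
    Subsingleton (F m (i+1) T.X₁) :=
  (F.map_inj_of hT h₁).subsingleton

include hT in
lemma F.ss₃ {i : ℕ} (h₁ : Subsingleton (F m (i+1) T.X₁)) (h₃ : Subsingleton (F m i T.X₂)) :
    Subsingleton (F m i T.X₃) :=
  (F.map_surj_of hT h₁).subsingleton

end LES

lemma F.ss_of_iso {i : ℕ} {X Y : ModuleCat.{u} S} (e : X ≅ Y) (h : Subsingleton (F m i X)) :
    Subsingleton (F m i Y) := by
  refine subsingleton_of_forall_eq 0 fun z => ?_
  rw [← F.map_id z, ← e.inv_hom_id, F.map_comp, Subsingleton.elim (F.map m i e.inv z) 0,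
    _root_.map_zero]

lemma F.ss_of_injective {i : ℕ} (hi : 0 < i) (J : ModuleCat.{u} S) [Injective J] :
    Subsingleton (F m i J) := by
  obtain ⟨i, rfl⟩ : ∃ j, i = j + 1 := ⟨i - 1, by omega⟩
  refine subsingleton_of_forall_eq 0 fun z => ?_
  obtain ⟨t, x, rfl⟩ := F.exists_of z
  rw [Ext.eq_zero_of_injective x, _root_.map_zero]

/-- elements of `F` are torsion -/
lemma F.torsion {i : ℕ} {X : ModuleCat.{u} S} (z : F m i X) : ∃ t, ∀ a ∈ m ^ t, a • z = 0 := by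
  obtain ⟨t, x, rfl⟩ := F.exists_of z
  refine ⟨t, fun a ha => ?_⟩
  rw [← _root_.map_smul]
  have : a • x = (Ext.mk₀ (a • 𝟙 (Sm m t))).comp x (zero_add i) := by
    rw [Ext.mk₀_smul, Ext.smul_comp, Ext.mk₀_id_comp]
  have h0 : a • 𝟙 (Sm m t) = 0 := by
    apply ModuleCat.hom_ext
    apply LinearMap.ext
    intro y
    obtain ⟨y, rfl⟩ := Submodule.Quotient.mk_surjective _ y
    change Submodule.Quotient.mk (a • y) = _
    exact (Submodule.Quotient.mk_eq_zero _).2 (Ideal.mul_mem_right _ _ ha)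
  rw [this, h0, Ext.mk₀_zero, Ext.zero_comp, _root_.map_zero]

end act
end TH
namespace TH
open CategoryTheory Limits Opposite Abelian
section ses
variable {S : Type u} [CommRing S] {A B C : Type u} [AddCommGroup A] [AddCommGroup B]
  [AddCommGroup C] [Module S A] [Module S B] [Module S C]

noncomputable abbrev sc (f : A →ₗ[S] B) (g : B →ₗ[S] C) (h : Function.Exact f g) :
    ShortComplex (ModuleCat.{u} S) :=
  ShortComplex.mk (ModuleCat.ofHom f) (ModuleCat.ofHom g) (by
    apply ModuleCat.hom_ext
    exact h.linearMap_comp_eq_zero)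

lemma sc_exact {f : A →ₗ[S] B} {g : B →ₗ[S] C} (h : Function.Exact f g)
    (hf : Function.Injective f) (hg : Function.Surjective g) : (sc f g h).ShortExact where
  exact := ModuleCat.shortComplex_exact _ h
  mono_f := (ModuleCat.mono_iff_injective _).2 hf
  epi_g := (ModuleCat.epi_iff_surjective _).2 hg

/-- quotient sequence -/
noncomputable abbrev scQ (N : Submodule S A) : ShortComplex (ModuleCat.{u} S) :=
  sc N.subtype N.mkQ (LinearMap.exact_subtype_mkQ N)

lemma scQ_exact (N : Submodule S A) : (scQ N).ShortExact :=
  sc_exact _ N.injective_subtype N.mkQ_surjective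

lemma ext_fg [IsNoetherianRing S] (i : ℕ) : ∀ (N : ModuleCat.{u} S) [Module.Finite S N]
    (X : ModuleCat.{u} S) (x : Ext N X i), ∃ X' : Submodule S X, X'.FG ∧
      ∃ y : Ext N (ModuleCat.of S X') i,
        y.comp (Ext.mk₀ (ModuleCat.ofHom X'.subtype)) (add_zero i) = x := by
  induction i with
  | zero =>
    intro N _ X x
    obtain ⟨f, rfl⟩ := Ext.homEquiv₀.symm.surjective x
    refine ⟨LinearMap.range f.hom, Module.Finite.iff_fg.1 inferInstance,
      Ext.mk₀ (ModuleCat.ofHom f.hom.rangeRestrict), ?_⟩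
    rw [Ext.mk₀_comp_mk₀]
    rfl
  | succ i ih =>
    intro N _ X x
    obtain ⟨n, f, hf⟩ := Module.Finite.exists_fin' S N
    let f' : (ULift.{u} (Fin n) → S) →ₗ[S] N :=
      f ∘ₗ (LinearEquiv.funCongrLeft S S Equiv.ulift.symm).toLinearMap
    have hf' : Function.Surjective f' := hf.comp (LinearEquiv.surjective _)
    have ex := LinearMap.shortExact_shortComplexKer hf'
    have hp : Projective (f'.shortComplexKer).X₂ := by
      exact ModuleCat.projective_of_free (ι := ULift (Fin n)) (Pi.basisFun S _)
    obtain ⟨y, hy⟩ := Ext.contravariant_sequence_exact₃ ex X x (Ext.eq_zero_of_projective _) (add_comm 1 i)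
    obtain ⟨X', hX', z, hz⟩ := ih _ X y
    refine ⟨X', hX', ex.extClass.comp z (add_comm 1 i), ?_⟩
    rw [Ext.comp_assoc_of_third_deg_zero, hz, hy]
end ses

section FG
variable {S : Type u} [CommRing S] {m : Ideal S} [IsNoetherianRing S]

lemma F.fg {i : ℕ} {X : ModuleCat.{u} S} (z : F m i X) : ∃ X' : Submodule S X, X'.FG ∧
    ∃ w, F.map m i (ModuleCat.ofHom X'.subtype) w = z := by
  obtain ⟨t, x, rfl⟩ := F.exists_of z
  obtain ⟨X', h, y, hy⟩ := ext_fg i _ X x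
  exact ⟨X', h, F.of m i _ t y, by rw [F.map_of, hy]⟩

/-- Baer criterion for torsion modules -/
lemma baer_torsion (X : Type u) [AddCommGroup X] [Module S X]
    (htor : ∀ x : X, ∃ t, ∀ a ∈ m ^ t, a • x = 0)
    (hext : ∀ (t : ℕ) (N : Submodule S (S ⧸ m ^ t)) (f : N →ₗ[S] X),
      ∃ g : (S ⧸ m ^ t) →ₗ[S] X, ∀ n : N, g n = f n) :
    Module.Injective S X := by
  apply Module.Baer.injective
  intro I f
  -- f kills m^s I
  have h1 : ∃ s, ∀ a ∈ m ^ s, ∀ y, a • f y = 0 := by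
    have hfg : (⊤ : Submodule S I).FG := Module.Finite.fg_top
    have : ∀ N : Submodule S I, N.FG → ∃ s, ∀ a ∈ m ^ s, ∀ y ∈ N, a • f y = 0 := by
      intro N hN
      induction N, hN using Submodule.fg_induction with
      | singleton x =>
        obtain ⟨t, ht⟩ := htor (f x)
        refine ⟨t, fun a ha y hy => ?_⟩
        obtain ⟨c, rfl⟩ := Submodule.mem_span_singleton.1 hy
        rw [_root_.map_smul, smul_comm, ht a ha, smul_zero]
      | sup N₁ N₂ _ _ h₁ h₂ =>
        obtain ⟨s₁, h₁⟩ := h₁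
        obtain ⟨s₂, h₂⟩ := h₂
        refine ⟨max s₁ s₂, fun a ha y hy => ?_⟩
        obtain ⟨y₁, hy₁, y₂, hy₂, rfl⟩ := Submodule.mem_sup.1 hy
        rw [_root_.map_add, smul_add, h₁ a (Ideal.pow_le_pow_right (le_max_left _ _) ha) _ hy₁,
          h₂ a (Ideal.pow_le_pow_right (le_max_right _ _) ha) _ hy₂, add_zero]
    obtain ⟨s, hs⟩ := this ⊤ hfg
    exact ⟨s, fun a ha y => hs a ha y trivial⟩
  obtain ⟨s, hs⟩ := h1
  obtain ⟨k, hk⟩ := Ideal.exists_pow_inf_eq_pow_smul m (M := S) I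
  have h2 : ∀ a (ha : a ∈ I), a ∈ m ^ (s + k) → f ⟨a, ha⟩ = 0 := by
    intro a ha ham
    have h3 : a ∈ m ^ s • I := by
      have h4 : a ∈ m ^ (s + k) • (⊤ : Submodule S S) ⊓ I := ⟨by simpa using ham, ha⟩
      rw [hk (s+k) (by omega), Nat.add_sub_cancel] at h4
      exact Submodule.smul_mono le_rfl inf_le_right h4
    have : ∃ hb : a ∈ I, f ⟨a, hb⟩ = 0 := by
      refine Submodule.smul_induction_on (p := fun b => ∃ hb : b ∈ I, f ⟨b, hb⟩ = 0) h3 ?_ ?_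
      · intro r hr n hn
        exact ⟨I.mul_mem_left r hn, (f.map_smul r ⟨n, hn⟩).trans (hs r hr _)⟩
      · rintro x y ⟨hx, hx'⟩ ⟨hy, hy'⟩
        refine ⟨I.add_mem hx hy, ?_⟩
        have := f.map_add ⟨x, hx⟩ ⟨y, hy⟩
        rw [hx', hy', add_zero] at this
        exact this
    exact this.2
  let q : I →ₗ[S] (S ⧸ m ^ (s + k)) := (m ^ (s+k)).mkQ ∘ₗ I.subtype
  have hker : LinearMap.ker q ≤ LinearMap.ker f := by
    intro a ha
    exact h2 a.1 a.2 ((Submodule.Quotient.mk_eq_zero _).1 ha)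
  let f1 : LinearMap.range q →ₗ[S] X :=
    (LinearMap.ker q).liftQ f hker ∘ₗ q.quotKerEquivRange.symm.toLinearMap
  obtain ⟨g, hg⟩ := hext (s + k) _ f1
  refine ⟨g ∘ₗ (m ^ (s+k)).mkQ, fun x hx => ?_⟩
  have := hg (q.rangeRestrict ⟨x, hx⟩)
  refine this.trans ?_
  have h5 : q.quotKerEquivRange.symm (q.rangeRestrict ⟨x, hx⟩) = Submodule.Quotient.mk ⟨x, hx⟩ := by
    rw [LinearEquiv.symm_apply_eq]; rfl
  change (LinearMap.ker q).liftQ f hker (q.quotKerEquivRange.symm (q.rangeRestrict ⟨x, hx⟩)) = _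
  rw [h5]; rfl

/-- `m`-power torsion submodule -/
def Gam (m : Ideal S) (J : Type u) [AddCommGroup J] [Module S J] : Submodule S J where
  carrier := {x | ∃ t, ∀ a ∈ m ^ t, a • x = 0}
  zero_mem' := ⟨0, by simp⟩
  add_mem' := by
    rintro x y ⟨s, hs⟩ ⟨t, ht⟩
    refine ⟨max s t, fun a ha => ?_⟩
    rw [smul_add, hs a (Ideal.pow_le_pow_right (le_max_left _ _) ha),
      ht a (Ideal.pow_le_pow_right (le_max_right _ _) ha), add_zero]
  smul_mem' := by
    rintro c x ⟨s, hs⟩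
    exact ⟨s, fun a ha => by rw [smul_comm, hs a ha, smul_zero]⟩

def Tors (m : Ideal S) (X : Type u) [AddCommGroup X] [Module S X] : Prop :=
  ∀ x : X, ∃ t, ∀ a ∈ m ^ t, a • x = 0

lemma quot_pow_kill {t : ℕ} {a : S} (ha : a ∈ m ^ t) (y : S ⧸ m ^ t) : a • y = 0 := by
  obtain ⟨y, rfl⟩ := Submodule.Quotient.mk_surjective _ y
  exact (Submodule.Quotient.mk_eq_zero _).2 (Ideal.mul_mem_right _ _ ha)

lemma tors_gam (J : Type u) [AddCommGroup J] [Module S J] : Tors m (Gam m J) := by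
  rintro ⟨x, t, ht⟩
  exact ⟨t, fun a ha => Subtype.ext (ht a ha)⟩

lemma gam_injective (J : Type u) [AddCommGroup J] [Module S J] [Module.Injective S J] :
    Module.Injective S (Gam m J) := by
  refine baer_torsion (m := m) _ (tors_gam J) fun t N f => ?_
  obtain ⟨g, hg⟩ := Module.Injective.out N.subtype N.injective_subtype ((Gam m J).subtype ∘ₗ f)
  refine ⟨g.codRestrict _ fun y => ⟨t, fun a ha => ?_⟩, fun n => Subtype.ext (hg n)⟩
  rw [← _root_.map_smul, quot_pow_kill ha, _root_.map_zero]

lemma F.map_surj_tors {X Y : Type u} [AddCommGroup X] [Module S X] [AddCommGroup Y] [Module S Y]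
    (hX : Tors m X) (f : X →ₗ[S] Y) (hf : Function.Surjective f) :
    Function.Surjective (F.map m 0 (ModuleCat.ofHom f)) := by
  intro z
  obtain ⟨t, y, rfl⟩ := F.exists_of z
  obtain ⟨y, rfl⟩ := Ext.homEquiv₀.symm.surjective y
  obtain ⟨x, hx⟩ := hf (y.hom (Submodule.Quotient.mk 1))
  obtain ⟨s, hs⟩ := hX x
  let g : (S ⧸ m ^ (max t s)) →ₗ[S] X := Submodule.liftQ (m ^ (max t s)) (LinearMap.toSpanSingleton S X x)
    (fun a ha => hs a (Ideal.pow_le_pow_right (le_max_right _ _) ha))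
  refine ⟨F.of m 0 _ (max t s) (Ext.mk₀ (ModuleCat.ofHom g)), ?_⟩
  rw [F.map_of, Ext.mk₀_comp_mk₀, ← F.of_tr (le_max_left t s)]
  congr 1
  change _ = (Ext.mk₀ _).comp (Ext.mk₀ y) _
  rw [Ext.mk₀_comp_mk₀]
  congr 1
  apply ModuleCat.hom_ext
  apply LinearMap.ext
  intro a
  obtain ⟨a, rfl⟩ := Submodule.Quotient.mk_surjective _ a
  change f (a • x) = y.hom (Submodule.Quotient.mk a)
  rw [_root_.map_smul, hx, ← _root_.map_smul, ← Submodule.Quotient.mk_smul, smul_eq_mul, mul_one]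

lemma exists_inj_emb (X : Type u) [AddCommGroup X] [Module S X] :
    ∃ J : ModuleCat.{u} S, Injective J ∧ ∃ f : X →ₗ[S] J, Function.Injective f :=
  ⟨Injective.under (ModuleCat.of S X), inferInstance, (Injective.ι (ModuleCat.of S X)).hom,
    (ModuleCat.mono_iff_injective _).1 inferInstance⟩

lemma F.ss_of_tors (i : ℕ) : ∀ (X : Type u) [AddCommGroup X] [Module S X], Tors m X →
    Subsingleton (F m (i+1) (ModuleCat.of S X)) := by
  induction i with
  | zero =>
    intro X _ _ hX
    obtain ⟨J, hJ, f, hf⟩ := exists_inj_emb (S := S) X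
    have := Module.injective_module_of_injective_object S J
    let g : X →ₗ[S] Gam m J := f.codRestrict _ fun x => by
      obtain ⟨t, ht⟩ := hX x
      exact ⟨t, fun a ha => by rw [← _root_.map_smul, ht a ha, _root_.map_zero]⟩
    have hg : Function.Injective g := fun x y h => hf (congrArg Subtype.val h)
    have := gam_injective (m := m) J
    have := Module.injective_object_of_injective_module S (Gam m J)
    have ex := sc_exact (f := g) (g := (LinearMap.range g).mkQ) (LinearMap.exact_map_mkQ_range g) hg
      (Submodule.mkQ_surjective _)
    refine subsingleton_of_forall_eq 0 fun z => ?_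
    obtain ⟨w, rfl⟩ := F.exact₁ ex (z := z)
      (@Subsingleton.elim _ (F.ss_of_injective Nat.one_pos (ModuleCat.of S (Gam m J))) _ _)
    obtain ⟨v, rfl⟩ := F.map_surj_tors (tors_gam J) _ (Submodule.mkQ_surjective (LinearMap.range g)) w
    exact F.exact₃' ex v
  | succ i ih =>
    intro X _ _ hX
    obtain ⟨J, hJ, f, hf⟩ := exists_inj_emb (S := S) X
    have := Module.injective_module_of_injective_object S J
    let g : X →ₗ[S] Gam m J := f.codRestrict _ fun x => by
      obtain ⟨t, ht⟩ := hX x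
      exact ⟨t, fun a ha => by rw [← _root_.map_smul, ht a ha, _root_.map_zero]⟩
    have hg : Function.Injective g := fun x y h => hf (congrArg Subtype.val h)
    have := gam_injective (m := m) J
    have := Module.injective_object_of_injective_module S (Gam m J)
    have ex := sc_exact (f := g) (g := (LinearMap.range g).mkQ) (LinearMap.exact_map_mkQ_range g) hg
      (Submodule.mkQ_surjective _)
    refine F.ss₁ ex (ih _ ?_) (F.ss_of_injective (Nat.succ_pos _) (ModuleCat.of S (Gam m J)))
    intro y
    obtain ⟨y, rfl⟩ := Submodule.mkQ_surjective _ y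
    obtain ⟨t, ht⟩ := tors_gam J y
    exact ⟨t, fun a ha => by rw [← _root_.map_smul, ht a ha, _root_.map_zero]⟩

end FG

section groth
variable {S : Type u} [CommRing S] [IsLocalRing S] [IsNoetherianRing S]
open IsLocalRing

omit [IsLocalRing S] [IsNoetherianRing S] in
lemma F.map_lsmul {m : Ideal S} {i : ℕ} {A : Type u} [AddCommGroup A] [Module S A] (x : S)
    (z : F m i (ModuleCat.of S A)) :
    F.map m i (ModuleCat.ofHom (LinearMap.lsmul S A x)) z = x • z := by
  have hfe : ModuleCat.ofHom (LinearMap.lsmul S A x) = x • 𝟙 (ModuleCat.of S A) := rfl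
  rw [hfe, F.map_smul, F.map_id]

omit [IsLocalRing S] [IsNoetherianRing S] in
lemma F.ss_of_lsmul {m : Ideal S} {i : ℕ} {A : Type u} [AddCommGroup A] [Module S A] {x : S}
    (hxm : x ∈ m) (hinj : Function.Injective (LinearMap.lsmul S A x))
    (h3 : Subsingleton (F m i (ModuleCat.of S (A ⧸ LinearMap.range (LinearMap.lsmul S A x))))) :
    Subsingleton (F m (i+1) (ModuleCat.of S A)) := by
  have ex := sc_exact (g := (LinearMap.range (LinearMap.lsmul S A x)).mkQ)
    (LinearMap.exact_map_mkQ_range _) hinj (Submodule.mkQ_surjective _)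
  have hinj := F.map_inj_of ex h3
  have hreg : ∀ z : F m (i+1) (ModuleCat.of S A), x • z = 0 → z = 0 := by
    intro z hz
    apply hinj
    rw [_root_.map_zero]
    exact (F.map_lsmul x z).trans hz
  refine subsingleton_of_forall_eq 0 fun z => ?_
  obtain ⟨t, ht⟩ := F.torsion z
  have := ht (x ^ t) (Ideal.pow_mem_pow hxm t)
  clear ht
  induction t with
  | zero => simpa using this
  | succ t iht =>
    apply iht
    rw [pow_succ', mul_smul] at this
    exact hreg _ this

omit [IsLocalRing S] [IsNoetherianRing S] in
lemma lsmul_inj (q : PrimeSpectrum S) {x : S} (hxq : x ∉ q.asIdeal) :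
    Function.Injective (LinearMap.lsmul S (S ⧸ q.asIdeal) x) := by
  rw [injective_iff_map_eq_zero]
  intro y hy
  obtain ⟨y, rfl⟩ := Submodule.Quotient.mk_surjective _ y
  have : x * y ∈ q.asIdeal := (Submodule.Quotient.mk_eq_zero _).1 hy
  exact (Submodule.Quotient.mk_eq_zero _).2 ((q.2.mem_or_mem this).resolve_left hxq)

omit [IsLocalRing S] [IsNoetherianRing S] in
lemma supp_lsmul (q : PrimeSpectrum S) {x : S} (hxq : x ∉ q.asIdeal) {q' : PrimeSpectrum S}
    (hq' : q' ∈ Module.support S ((S ⧸ q.asIdeal) ⧸ LinearMap.range (LinearMap.lsmul S (S ⧸ q.asIdeal) x))) :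
    q < q' := by
  rw [Module.mem_support_iff_of_finite] at hq'
  rw [lt_iff_le_and_ne]
  constructor
  · refine le_trans (a := q.asIdeal) (c := q'.asIdeal) (fun a ha => ?_) hq'
    rw [Module.mem_annihilator]
    intro y
    obtain ⟨y, rfl⟩ := Submodule.Quotient.mk_surjective _ y
    obtain ⟨y, rfl⟩ := Submodule.Quotient.mk_surjective _ y
    rw [← Submodule.Quotient.mk_smul, ← Submodule.Quotient.mk_smul]
    have h0 : (Submodule.Quotient.mk (a • y) : S ⧸ q.asIdeal) = 0 :=
      (Submodule.Quotient.mk_eq_zero _).2 (Ideal.mul_mem_right _ _ ha)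
    rw [h0]
    rfl
  · rintro rfl
    refine hxq (hq' ?_)
    rw [Module.mem_annihilator]
    intro y
    obtain ⟨y, rfl⟩ := Submodule.Quotient.mk_surjective _ y
    rw [← Submodule.Quotient.mk_smul]
    exact (Submodule.Quotient.mk_eq_zero _).2 ⟨y, rfl⟩

set_option maxHeartbeats 1000000 in
lemma F.groth_fg (n : ℕ) : ∀ (N : Type u) [AddCommGroup N] [Module S N] (_ : Module.Finite S N),
    (∀ q ∈ Module.support S N, Order.coheight q ≤ n) → ∀ i, n < i →
      Subsingleton (F (maximalIdeal S) i (ModuleCat.of S N)) := by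
  induction n using Nat.strong_induction_on with
  | _ n ih =>
  intro N _ _ hN
  refine IsNoetherianRing.induction_on_isQuotientEquivQuotientPrime S hN
    (motive := fun N _ _ _ => (∀ q ∈ Module.support S N, Order.coheight q ≤ n) → ∀ i, n < i →
      Subsingleton (F (maximalIdeal S) i (ModuleCat.of S N))) ?_ ?_ ?_
  · intro N _ _ _ _ _ i hi
    obtain ⟨i, rfl⟩ : ∃ j, i = j + 1 := ⟨i - 1, by omega⟩
    exact F.ss_of_tors i N (fun x => ⟨0, fun a _ => Subsingleton.elim _ _⟩)
  · intro N _ _ _ q e hsupp i hi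
    refine F.ss_of_iso e.symm.toModuleIso ?_
    have hq : Order.coheight q ≤ n := by
      apply hsupp
      rw [e.support_eq, Module.mem_support_iff_of_finite, Ideal.annihilator_quotient]
    obtain ⟨i, rfl⟩ : ∃ j, i = j + 1 := ⟨i - 1, by omega⟩
    by_cases hqm : q.asIdeal = maximalIdeal S
    · refine F.ss_of_tors i _ (fun x => ⟨1, fun a ha => ?_⟩)
      obtain ⟨x, rfl⟩ := Submodule.Quotient.mk_surjective _ x
      refine (Submodule.Quotient.mk_eq_zero _).2 (Ideal.mul_mem_right _ _ ?_)
      simpa [hqm] using ha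
    · have hlt : q.asIdeal < maximalIdeal S :=
        lt_of_le_of_ne (le_maximalIdeal q.2.ne_top) hqm
      obtain ⟨x, hxm, hxq⟩ := SetLike.exists_of_lt hlt
      have hf := lsmul_inj q hxq
      have hco := fun q' => supp_lsmul q hxq (q' := q')
      have hn : 0 < n := by
        rcases Nat.eq_zero_or_pos n with rfl | h
        · exfalso
          have h0 : Order.coheight q = 0 := by simpa using hq
          rw [Order.coheight_eq_zero] at h0
          have := h0 (b := (⟨maximalIdeal S, inferInstance⟩ : PrimeSpectrum S)) hlt.le
          exact absurd (show maximalIdeal S ≤ q.asIdeal from this) (not_le_of_gt hlt)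
        · exact h
      have h3 : Subsingleton (F (maximalIdeal S) i
          (ModuleCat.of S ((S ⧸ q.asIdeal) ⧸ LinearMap.range (LinearMap.lsmul S (S ⧸ q.asIdeal) x)))) := by
        refine ih (n - 1) (by omega) _ inferInstance (fun q' hq' => ?_) i (by omega)
        have h1 := Order.coheight_add_one_le (hco q' hq')
        have h2 := h1.trans hq
        obtain ⟨n, rfl⟩ : ∃ j, n = j + 1 := ⟨n - 1, by omega⟩
        push_cast at h2
        simpa using ENat.add_le_add_iff_right (ENat.one_ne_top) |>.1 h2
      exact F.ss_of_lsmul hxm hf h3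
  · intro N₁ _ _ _ N₂ _ _ _ N₃ _ _ _ f g hf hg hfg h₁ h₃ hs i hi
    rw [Module.support_of_exact hfg hf hg] at hs
    exact F.ss₂ (sc_exact hfg hf hg) (h₁ (fun q hq => hs q (Or.inl hq)) i hi)
      (h₃ (fun q hq => hs q (Or.inr hq)) i hi)

lemma F.groth {d : ℕ} (hd : ringKrullDim S = d) (X : ModuleCat.{u} S) {i : ℕ} (hi : d < i) :
    Subsingleton (F (maximalIdeal S) i X) := by
  refine subsingleton_of_forall_eq 0 fun z => ?_
  obtain ⟨X', hX', w, rfl⟩ := F.fg z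
  have : Module.Finite S X' := Module.Finite.iff_fg.2 hX'
  have := F.groth_fg d X' this (fun q _ => ?_) i hi
  · rw [Subsingleton.elim w 0, _root_.map_zero]
  · have := Order.coheight_le_krullDim q
    rw [← ringKrullDim, hd] at this
    exact_mod_cast this

end groth
end TH
namespace TH
open CategoryTheory Limits Opposite Abelian
section extlem
variable {S : Type u} [CommRing S] {T : ShortComplex (ModuleCat.{u} S)} (hT : T.ShortExact)
  (Y : ModuleCat.{u} S)
include hT

/-- dimension shift, surjectivity -/
lemma ext_shift_surj {i j : ℕ} (h : 1 + i = j) (h2 : Subsingleton (Ext T.X₂ Y j)) (x : Ext T.X₃ Y j) :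
    ∃ y : Ext T.X₁ Y i, hT.extClass.comp y h = x :=
  Ext.contravariant_sequence_exact₃ hT Y x (Subsingleton.elim _ _) h

lemma ext_shift_inj {i j : ℕ} (h : 1 + i = j) (h2 : Subsingleton (Ext T.X₂ Y i)) (y : Ext T.X₁ Y i)
    (hy : hT.extClass.comp y h = 0) : y = 0 := by
  obtain ⟨z, rfl⟩ := Ext.contravariant_sequence_exact₁ hT Y y h hy
  rw [Subsingleton.elim z 0, Ext.comp_zero]

lemma ext_ss₁ {i j : ℕ} (h : 1 + i = j) (h2 : Subsingleton (Ext T.X₂ Y i))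
    (h3 : Subsingleton (Ext T.X₃ Y j)) : Subsingleton (Ext T.X₁ Y i) :=
  subsingleton_of_forall_eq 0 fun _ => ext_shift_inj hT Y h h2 _ (Subsingleton.elim _ _)

lemma ext_ss₃ {i j : ℕ} (h : 1 + i = j) (h2 : Subsingleton (Ext T.X₂ Y j))
    (h3 : Subsingleton (Ext T.X₁ Y i)) : Subsingleton (Ext T.X₃ Y j) :=
  subsingleton_of_forall_eq 0 fun x => by
    obtain ⟨y, rfl⟩ := ext_shift_surj hT Y h h2 x
    rw [Subsingleton.elim y 0, Ext.comp_zero]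

lemma ext_ss₂ {i : ℕ} (h1 : Subsingleton (Ext T.X₁ Y i))
    (h3 : Subsingleton (Ext T.X₃ Y i)) : Subsingleton (Ext T.X₂ Y i) :=
  subsingleton_of_forall_eq 0 fun x => by
    obtain ⟨y, rfl⟩ := Ext.contravariant_sequence_exact₂ hT Y x (Subsingleton.elim _ _)
    rw [Subsingleton.elim y 0, Ext.comp_zero]

end extlem

section misc
variable {S : Type u} [CommRing S]

lemma ext_proj (P Y : ModuleCat.{u} S) [Projective P] (i : ℕ) (hi : 0 < i) : Subsingleton (Ext P Y i) := by
  obtain ⟨i, rfl⟩ : ∃ j, i = j + 1 := ⟨i - 1, by omega⟩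
  exact subsingleton_of_forall_eq 0 Ext.eq_zero_of_projective

lemma ext_ss_iso {X X' Y Y' : ModuleCat.{u} S} (e : X ≅ X') (e' : Y ≅ Y') (i : ℕ)
    (h : Subsingleton (Ext X Y i)) : Subsingleton (Ext X' Y' i) :=
  subsingleton_of_forall_eq 0 fun x => by
    have : (Ext.mk₀ e.inv).comp ((Ext.mk₀ e.hom).comp (x.comp (Ext.mk₀ e'.inv) (add_zero i)) (zero_add i))
      (zero_add i) = x.comp (Ext.mk₀ e'.inv) (add_zero i) := by
      rw [Ext.mk₀_comp_mk₀_assoc, e.inv_hom_id, Ext.mk₀_id_comp]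
    have h2 : (x.comp (Ext.mk₀ e'.inv) (add_zero i)).comp (Ext.mk₀ e'.hom) (add_zero i) = x := by
      rw [Ext.comp_assoc _ _ _ (add_zero i) (add_zero 0) (by omega), Ext.mk₀_comp_mk₀, e'.inv_hom_id,
        Ext.comp_mk₀_id]
    rw [← h2, ← this, Subsingleton.elim ((Ext.mk₀ e.hom).comp _ _) 0, Ext.comp_zero, Ext.zero_comp]

end misc

section loc
variable {R : Type u} [CommRing R] [IsNoetherianRing R] (M : Submonoid R)

omit [IsNoetherianRing R] in
lemma loc_exact {A B C : Type u} [AddCommGroup A] [AddCommGroup B]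
    [AddCommGroup C] [Module R A] [Module R B] [Module R C] {f : A →ₗ[R] B} {g : B →ₗ[R] C}
    (h : Function.Exact f g) : Function.Exact (LocalizedModule.map M f) (LocalizedModule.map M g) :=
  LocalizedModule.map_exact M f g h

lemma loc_hom {N D : Type u} [AddCommGroup N] [AddCommGroup D] [Module R N] [Module R D]
    [Module.Finite R N] (φ : LocalizedModule M N →ₗ[Localization M] LocalizedModule M D) :
    ∃ (s : M) (ψ : N →ₗ[R] D), LocalizedModule.map M ψ = s • φ := by
  have := Module.finitePresentation_of_finite R N
  obtain ⟨⟨ψ, s⟩, h⟩ := IsLocalizedModule.surj M (LocalizedModule.map M (M := N) (N := D)) φ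
  exact ⟨s, ψ, h.symm⟩

omit [IsNoetherianRing R] in
lemma loc_inv_smul (s : M) {N : Type u} [AddCommGroup N] [Module R N]
    (x : LocalizedModule M N) : IsLocalization.mk' (Localization M) (1 : R) s • (s • x) = x := by
  have : s • x = (algebraMap R (Localization M) s) • x := by
    rw [algebraMap_smul]; rfl
  rw [this, smul_smul, IsLocalization.mk'_spec, _root_.map_one, one_smul]

omit [IsNoetherianRing R] in
lemma loc_smul_cancel (s : M) {N : Type u} [AddCommGroup N] [Module R N]
    {x y : LocalizedModule M N} (h : s • x = s • y) : x = y := by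
  rw [← loc_inv_smul M s x, h, loc_inv_smul]

lemma loc_ext (D : Type u) [AddCommGroup D] [Module R D] (i : ℕ) :
    ∀ (N : Type u) [AddCommGroup N] [Module R N] [Module.Finite R N],
    Subsingleton (Ext (ModuleCat.of R N) (ModuleCat.of R D) i) →
    Subsingleton (Ext (ModuleCat.of (Localization M) (LocalizedModule M N))
      (ModuleCat.of (Localization M) (LocalizedModule M D)) i) := by
  induction i with
  | zero =>
    intro N _ _ _ h
    refine subsingleton_of_forall_eq 0 fun x => ?_
    obtain ⟨φ, rfl⟩ := Ext.homEquiv₀.symm.surjective x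
    obtain ⟨s, ψ, hψ⟩ := loc_hom M φ.hom
    have h0 : ψ = 0 := by
      have h1 := Ext.homEquiv₀.symm.injective (Subsingleton.elim
        (Ext.mk₀ (ModuleCat.ofHom ψ)) (Ext.mk₀ 0))
      exact congrArg ModuleCat.Hom.hom h1
    have h2 : φ = 0 := by
      apply ModuleCat.hom_ext
      apply LinearMap.ext
      intro x
      apply loc_smul_cancel M s
      have := congrArg (fun f => f x) hψ
      simp only [h0, _root_.map_zero] at this
      simpa using this.symm
    rw [h2]
    exact Ext.mk₀_zero (ModuleCat.of (Localization M) (LocalizedModule M N)) _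
  | succ i ih =>
    intro N _ _ _ h
    obtain ⟨P, _, _, _, _, f, hf⟩ := Module.exists_finite_presentation R N
    have ex := sc_exact (f := (LinearMap.ker f).subtype) (g := f) f.exact_subtype_ker_map
      (Submodule.injective_subtype _) hf
    have ex' := sc_exact (loc_exact M f.exact_subtype_ker_map)
      (LocalizedModule.map_injective M _ (Submodule.injective_subtype _))
      (LocalizedModule.map_surjective M f hf)
    have hfree : Module.Free (Localization M) (LocalizedModule M P) :=
      Module.free_of_isLocalizedModule M (LocalizedModule.mkLinearMap M P)
    have hpr : Projective (ModuleCat.of R P) := ModuleCat.projective_of_free (Module.Free.chooseBasis R P)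
    have hpr' : Projective (ModuleCat.of (Localization M) (LocalizedModule M P)) :=
      ModuleCat.projective_of_free (Module.Free.chooseBasis _ _)
    rcases i with _ | i
    · refine subsingleton_of_forall_eq 0 fun x => ?_
      obtain ⟨y, rfl⟩ := ext_shift_surj ex' _ (add_zero 1) (ext_proj _ _ _ Nat.one_pos) x
      obtain ⟨φ, rfl⟩ := Ext.homEquiv₀.symm.surjective y
      obtain ⟨s, ψ, hψ⟩ := loc_hom M φ.hom
      obtain ⟨z, hz⟩ := Ext.contravariant_sequence_exact₁ ex (ModuleCat.of R D)
        (Ext.mk₀ (ModuleCat.ofHom ψ)) (add_zero 1) (Subsingleton.elim _ _)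
      obtain ⟨χ, rfl⟩ := Ext.homEquiv₀.symm.surjective z
      have h1 : ModuleCat.ofHom (LinearMap.ker f).subtype ≫ χ = ModuleCat.ofHom ψ :=
        Ext.homEquiv₀.symm.injective ((Ext.mk₀_comp_mk₀ _ _).symm.trans hz)
      have h2 : χ.hom ∘ₗ (LinearMap.ker f).subtype = ψ := congrArg ModuleCat.Hom.hom h1
      have h3 : φ = ModuleCat.ofHom (LocalizedModule.map M (LinearMap.ker f).subtype) ≫
          ModuleCat.ofHom (IsLocalization.mk' (Localization M) (1 : R) s • LocalizedModule.map M χ.hom) := by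
        apply ModuleCat.hom_ext
        apply LinearMap.ext
        intro x
        refine (loc_inv_smul M s _).symm.trans ?_
        have h4 := congrArg (fun f => f x) hψ
        change _ = IsLocalization.mk' (Localization M) (1 : R) s •
          (LocalizedModule.map M χ.hom (LocalizedModule.map M (LinearMap.ker f).subtype x))
        congr 1
        refine h4.symm.trans ?_
        rw [← h2]
        induction x using LocalizedModule.induction_on with
        | h m s => simp [LocalizedModule.map_mk]
      rw [h3]
      refine (congrArg (fun t => ex'.extClass.comp t (add_zero 1)) (Ext.mk₀_comp_mk₀ _ _).symm).trans ?_
      exact ex'.extClass_comp_assoc _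
    · exact ext_ss₃ ex' _ (by omega) (ext_proj _ _ _ (by omega)) (ih _ (ext_ss₁ ex _ (by omega)
        (ext_proj _ _ _ (by omega)) h))
end loc

/-- dualizing modules over a local ring, in terms of `Abelian.Ext` -/
structure Dz (S : Type u) [CommRing S] [IsLocalRing S] (D : Type u) [AddCommGroup D] [Module S D] :
    Prop where
  fin : Module.Finite S D
  hom : Function.Bijective (fun r : S => r • (LinearMap.id : D →ₗ[S] D))
  ext : ∀ i, 0 < i → Subsingleton (Ext (ModuleCat.of S D) (ModuleCat.of S D) i)
  bdd : ∃ n, ∀ i, n < i →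
    Subsingleton (Ext (ModuleCat.of S (S ⧸ IsLocalRing.maximalIdeal S)) (ModuleCat.of S D) i)

section dzloc
variable {R : Type u} [CommRing R] (p : Ideal R) [p.IsPrime]

lemma res_equiv : Nonempty (LocalizedModule p.primeCompl (R ⧸ p) ≃ₗ[Localization.AtPrime p]
    Localization.AtPrime p ⧸ IsLocalRing.maximalIdeal (Localization.AtPrime p)) := by
  let e : LocalizedModule p.primeCompl (R ⧸ p) := LocalizedModule.mkLinearMap p.primeCompl _
    (Submodule.Quotient.mk 1)
  let f := LinearMap.toSpanSingleton (Localization.AtPrime p) _ e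
  have hsurj : Function.Surjective f := by
    intro y
    obtain ⟨⟨a, s⟩, rfl⟩ := IsLocalizedModule.mk'_surjective p.primeCompl
      (LocalizedModule.mkLinearMap p.primeCompl _) y
    obtain ⟨a, rfl⟩ := Submodule.Quotient.mk_surjective _ a
    refine ⟨IsLocalization.mk' _ a s, ?_⟩
    change IsLocalization.mk' (Localization.AtPrime p) a s • e = _
    have he : e = IsLocalizedModule.mk' (LocalizedModule.mkLinearMap p.primeCompl _)
      (Submodule.Quotient.mk 1 : R ⧸ p) 1 := (IsLocalizedModule.mk'_one p.primeCompl _ _).symm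
    rw [he, IsLocalizedModule.mk'_smul_mk', mul_one,
      ← Submodule.Quotient.mk_smul, smul_eq_mul, mul_one]
    rfl
  have hker : LinearMap.ker f = IsLocalRing.maximalIdeal (Localization.AtPrime p) := by
    apply le_antisymm
    · apply IsLocalRing.le_maximalIdeal
      intro htop
      have h1 : (1 : Localization.AtPrime p) ∈ LinearMap.ker f := by rw [htop]; trivial
      have h2 : (1 : Localization.AtPrime p) • e = 0 := h1
      rw [one_smul, IsLocalizedModule.eq_zero_iff p.primeCompl] at h2
      obtain ⟨c, hc⟩ := h2
      have hc' : (c : R) • (Submodule.Quotient.mk 1 : R ⧸ p) = 0 := hc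
      rw [← Submodule.Quotient.mk_smul, Submodule.Quotient.mk_eq_zero, smul_eq_mul, mul_one] at hc'
      exact c.2 hc'
    · rw [← IsLocalization.AtPrime.map_eq_maximalIdeal p, Ideal.map_le_iff_le_comap]
      intro a ha
      change algebraMap R (Localization.AtPrime p) a • e = 0
      rw [algebraMap_smul, ← _root_.map_smul, ← Submodule.Quotient.mk_smul, smul_eq_mul, mul_one,
        (Submodule.Quotient.mk_eq_zero _).2 ha, _root_.map_zero]
  exact ⟨(f.quotKerEquivOfSurjective hsurj).symm ≪≫ₗ Submodule.quotEquivOfEq _ _ hker⟩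

lemma dz_loc [IsNoetherianRing R] (D : Type u) [AddCommGroup D] [Module R D]
    (hD : IsDualizingModule R D) :
    Dz (Localization.AtPrime p) (LocalizedModule p.primeCompl D) := by
  obtain ⟨h1, ⟨n, h2⟩, h3, h4⟩ := hD
  have := Module.finitePresentation_of_finite R D
  refine ⟨Module.Finite.of_isLocalizedModule p.primeCompl (LocalizedModule.mkLinearMap p.primeCompl D),
    ⟨?_, ?_⟩, ?_, n, ?_⟩
  · refine (injective_iff_map_eq_zero (LinearMap.toSpanSingleton (Localization.AtPrime p) _
      (LinearMap.id : LocalizedModule p.primeCompl D →ₗ[Localization.AtPrime p] _))).2 ?_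
    intro a ha
    obtain ⟨⟨r, s⟩, rfl⟩ := IsLocalization.mk'_surjective p.primeCompl a
    have h5 : LocalizedModule.map p.primeCompl (r • (LinearMap.id : D →ₗ[R] D)) = 0 := by
      apply LinearMap.ext
      intro x
      have h6 := congrArg (fun f => (algebraMap R (Localization.AtPrime p) s) • f x) ha
      change (algebraMap R (Localization.AtPrime p) s) • (IsLocalization.mk' (Localization.AtPrime p) r s • x) = 
        (algebraMap R (Localization.AtPrime p) s) • 0 at h6
      rw [smul_smul, mul_comm, IsLocalization.mk'_spec, smul_zero, algebraMap_smul] at h6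
      induction x using LocalizedModule.induction_on with
      | h m t => simpa [LocalizedModule.map_mk, LocalizedModule.smul'_mk] using h6
    rw [IsLocalizedModule.eq_zero_iff p.primeCompl] at h5
    obtain ⟨c, hc⟩ := h5
    have hc' : ((c : R) * r) • (LinearMap.id : D →ₗ[R] D) = (0 : R) • LinearMap.id := by
      rw [zero_smul, mul_smul]; exact hc
    exact (IsLocalization.mk'_eq_zero_iff _ _).2 ⟨c, h3.1 hc'⟩
  · intro φ
    obtain ⟨s, ψ, hψ⟩ := loc_hom p.primeCompl φ
    obtain ⟨r, rfl⟩ := h3.2 ψ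
    refine ⟨IsLocalization.mk' _ r s, ?_⟩
    apply LinearMap.ext
    intro x
    have h6 := congrArg (fun f => f x) hψ
    rw [← loc_inv_smul p.primeCompl s (φ x)]
    refine Eq.trans ?_ (congrArg (fun y => IsLocalization.mk' (Localization.AtPrime p) (1 : R) s • y) h6)
    change IsLocalization.mk' (Localization.AtPrime p) r s • x = _
    rw [IsLocalization.mk'_eq_mul_mk'_one, mul_comm, mul_smul, algebraMap_smul]
    congr 1
    induction x using LocalizedModule.induction_on with
    | h m t => simp [LocalizedModule.map_mk, LocalizedModule.smul'_mk]
  · intro i hi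
    exact loc_ext p.primeCompl D i D (subsingleton_of_isZero (h4 i hi))
  · intro i hi
    obtain ⟨e⟩ := res_equiv p
    exact ext_ss_iso e.toModuleIso (Iso.refl _) i
      (loc_ext p.primeCompl D i _ (subsingleton_of_isZero (h2 _ _ _ i hi)))

end dzloc
end TH
namespace TH
open CategoryTheory Limits Opposite Abelian IsLocalRing
section bass
variable {S : Type u} [CommRing S] [IsNoetherianRing S] 

lemma ext_ss_of_supp (D : ModuleCat.{u} S) (i : ℕ) (N : Type u) [AddCommGroup N] [Module S N]
    (hN : Module.Finite S N) : 
    (∀ q ∈ Module.support S N, Subsingleton (Ext (ModuleCat.of S (S ⧸ q.asIdeal)) D i)) →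
      Subsingleton (Ext (ModuleCat.of S N) D i) := by
  refine IsNoetherianRing.induction_on_isQuotientEquivQuotientPrime S hN
    (motive := fun N _ _ _ =>
      (∀ q ∈ Module.support S N, Subsingleton (Ext (ModuleCat.of S (S ⧸ q.asIdeal)) D i)) →
      Subsingleton (Ext (ModuleCat.of S N) D i)) ?_ ?_ ?_
  · intro N _ _ _ _ _
    refine subsingleton_of_forall_eq 0 fun x => ?_
    have : 𝟙 (ModuleCat.of S N) = 0 := by
      apply ModuleCat.hom_ext
      apply LinearMap.ext
      intro x
      exact Subsingleton.elim (α := N) _ _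
    rw [← Ext.mk₀_id_comp x, this, Ext.mk₀_zero, Ext.zero_comp]
  · intro N _ _ _ q e h
    refine ext_ss_iso e.symm.toModuleIso (Iso.refl _) i (h q ?_)
    rw [e.support_eq, Module.mem_support_iff_of_finite, Ideal.annihilator_quotient]
  · intro N₁ _ _ _ N₂ _ _ _ N₃ _ _ _ f g hf hg hfg h₁ h₃ hs
    rw [Module.support_of_exact hfg hf hg] at hs
    exact ext_ss₂ (sc_exact hfg hf hg) D (h₁ (fun q hq => hs q (Or.inl hq)))
      (h₃ (fun q hq => hs q (Or.inr hq)))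

variable [IsLocalRing S]

lemma ext_ss_of_lsmul (D : ModuleCat.{u} S) [Module.Finite S D] {i : ℕ} {A : Type u} [AddCommGroup A] [Module S A]
    [Module.Finite S A] {x : S}
    (hxm : x ∈ maximalIdeal S) (hinj : Function.Injective (LinearMap.lsmul S A x))
    (h3 : Subsingleton (Ext (ModuleCat.of S (A ⧸ LinearMap.range (LinearMap.lsmul S A x))) D (i+1))) :
    Subsingleton (Ext (ModuleCat.of S A) D i) := by
  have ex := sc_exact (g := (LinearMap.range (LinearMap.lsmul S A x)).mkQ)
    (LinearMap.exact_map_mkQ_range _) hinj (Submodule.mkQ_surjective _)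
  have hs : ∀ y : Ext (ModuleCat.of S A) D i, ∃ z : Ext (ModuleCat.of S A) D i, x • z = y := by
    intro y
    obtain ⟨z, hz⟩ := Ext.contravariant_sequence_exact₁ ex D y (add_comm 1 i) (Subsingleton.elim _ _)
    refine ⟨z, Eq.trans ?_ hz⟩
    have hfe : ModuleCat.ofHom (LinearMap.lsmul S A x) = x • 𝟙 (ModuleCat.of S A) := rfl
    change _ = (Ext.mk₀ (ModuleCat.ofHom (LinearMap.lsmul S A x))).comp z _
    rw [hfe, Ext.mk₀_smul, Ext.smul_comp, Ext.mk₀_id_comp]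
  have hfin : Module.Finite S (Ext (ModuleCat.of S A) D i) := inferInstance
  suffices h : (⊤ : Submodule S (Ext (ModuleCat.of S A) D i)) = ⊥ from
    (Submodule.subsingleton_iff S).1 (subsingleton_iff_bot_eq_top.1 h.symm)
  refine Submodule.eq_bot_of_le_smul_of_le_jacobson_bot (maximalIdeal S) ⊤ hfin.fg_top ?_ ?_
  · intro y _
    obtain ⟨z, rfl⟩ := hs y
    exact Submodule.smul_mem_smul hxm trivial
  · exact (jacobson_eq_maximalIdeal ⊥ bot_ne_top).ge

lemma ext_ss_all (D : ModuleCat.{u} S) [Module.Finite S D] (c : ℕ)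
    (hk : ∀ i, c ≤ i → Subsingleton (Ext (ModuleCat.of S (S ⧸ maximalIdeal S)) D i))
    (N : Type u) [AddCommGroup N] [Module S N] [hN : Module.Finite S N] (i : ℕ) (hi : c ≤ i) :
    Subsingleton (Ext (ModuleCat.of S N) D i) := by
  suffices ∀ I : Ideal S, I.IsPrime → ∀ i, c ≤ i → Subsingleton (Ext (ModuleCat.of S (S ⧸ I)) D i) from
    ext_ss_of_supp D i N hN fun q _ => this q.asIdeal q.2 i hi
  intro I
  induction I using IsNoetherian.induction with
  | hgt I ih =>
  intro hI i hi
  by_cases hqm : I = maximalIdeal S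
  · subst hqm; exact hk i hi
  · obtain ⟨x, hxm, hxq⟩ := SetLike.exists_of_lt (lt_of_le_of_ne (le_maximalIdeal hI.ne_top) hqm)
    refine ext_ss_of_lsmul D hxm (lsmul_inj ⟨I, hI⟩ hxq) (ext_ss_of_supp _ _ _ inferInstance ?_)
    intro q' hq'
    exact ih q'.asIdeal (supp_lsmul ⟨I, hI⟩ hxq hq') q'.2 (i+1) (by omega)

end bass
end TH
namespace TH
open CategoryTheory Limits Opposite Abelian IsLocalRing
section bass2
variable {S : Type u} [CommRing S]

lemma ext_comp_lsmul {N : ModuleCat.{u} S} {Y : Type u} [AddCommGroup Y] [Module S Y] (x : S) {i : ℕ}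
    (z : Ext N (ModuleCat.of S Y) i) :
    z.comp (Ext.mk₀ (ModuleCat.ofHom (LinearMap.lsmul S Y x))) (add_zero i) = x • z := by
  have hfe : ModuleCat.ofHom (LinearMap.lsmul S Y x) = x • 𝟙 (ModuleCat.of S Y) := rfl
  rw [hfe, Ext.mk₀_smul, Ext.comp_smul, Ext.comp_mk₀_id]

lemma ext_smul_zero {N Y : ModuleCat.{u} S} {x : S} (hx : ∀ n : N, x • n = 0) {i : ℕ}
    (z : Ext N Y i) : x • z = 0 := by
  have : x • 𝟙 N = 0 := by
    apply ModuleCat.hom_ext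
    apply LinearMap.ext
    intro n
    exact hx n
  rw [← Ext.mk₀_id_comp z, ← Ext.smul_comp, ← Ext.mk₀_smul, this, Ext.mk₀_zero, Ext.zero_comp]

variable {Y Y' : Type u} [AddCommGroup Y] [Module S Y] [AddCommGroup Y'] [Module S Y'] {x : S}
  {g : Y →ₗ[S] Y'} (hx : Function.Injective (LinearMap.lsmul S Y x))
  (hg : Function.Exact (LinearMap.lsmul S Y x) g) (hs : Function.Surjective g)
include hx hg hs

lemma cov3 (N : ModuleCat.{u} S) {i : ℕ} (h0 : Subsingleton (Ext N (ModuleCat.of S Y) i))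
    (h1 : Subsingleton (Ext N (ModuleCat.of S Y) (i+1))) :
    Subsingleton (Ext N (ModuleCat.of S Y') i) := by
  refine subsingleton_of_forall_eq 0 fun z => ?_
  obtain ⟨w, rfl⟩ := Ext.covariant_sequence_exact₃ N (sc_exact hg hx hs) z rfl (Subsingleton.elim _ _)
  rw [Subsingleton.elim w 0, Ext.zero_comp]

lemma cov_kill (N : ModuleCat.{u} S) (hN : ∀ n : N, x • n = 0) {i : ℕ}
    (h : Subsingleton (Ext N (ModuleCat.of S Y') i)) :
    Subsingleton (Ext N (ModuleCat.of S Y) (i+1)) := by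
  refine subsingleton_of_forall_eq 0 fun z => ?_
  obtain ⟨w, rfl⟩ := Ext.covariant_sequence_exact₁ N (sc_exact hg hx hs) z
    ((ext_comp_lsmul x z).trans (ext_smul_zero hN z)) rfl
  rw [Subsingleton.elim w 0, Ext.zero_comp]

omit hg hs in
lemma cov_kill0 (N : ModuleCat.{u} S) (hN : ∀ n : N, x • n = 0)  :
    Subsingleton (Ext N (ModuleCat.of S Y) 0) := by
  refine subsingleton_of_forall_eq 0 fun z => ?_
  obtain ⟨f, rfl⟩ := Ext.homEquiv₀.symm.surjective z
  have : f = 0 := by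
    apply ModuleCat.hom_ext
    apply LinearMap.ext
    intro n
    apply hx
    refine (f.hom.map_smul x n).symm.trans ?_
    rw [hN, _root_.map_zero]
    exact (_root_.map_zero (LinearMap.lsmul S Y x)).symm
  rw [this]
  exact Ext.mk₀_zero _ _

lemma hom_seq (A : Type u) [AddCommGroup A] [Module S A]
    (h : Subsingleton (Ext (ModuleCat.of S A) (ModuleCat.of S Y) 1)) :
    Function.Injective (LinearMap.lsmul S (A →ₗ[S] Y) x) ∧
    Function.Exact (LinearMap.lsmul S (A →ₗ[S] Y) x) (LinearMap.compRight S g : (A →ₗ[S] Y) →ₗ[S] (A →ₗ[S] Y')) ∧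
    Function.Surjective (LinearMap.compRight S g : (A →ₗ[S] Y) →ₗ[S] (A →ₗ[S] Y')) := by
  refine ⟨?_, ?_, ?_⟩
  · intro a b hab
    ext n
    exact hx (congrArg (fun f : A →ₗ[S] Y => f n) hab)
  · intro f
    constructor
    · intro hf
      have h0 : ∀ a, ∃ y, LinearMap.lsmul S Y x y = f a := fun a =>
        (hg (f a)).1 (congrArg (fun f : A →ₗ[S] Y' => f a) hf)
      choose y hy using h0
      refine ⟨⟨⟨y, fun a b => hx ?_⟩, fun r a => hx ?_⟩, ?_⟩
      · simp only [_root_.map_add, hy]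
      · simp only [_root_.map_smul, hy]; rfl
      · ext a; exact hy a
    · rintro ⟨f, rfl⟩
      ext a
      exact (hg _).2 ⟨f a, rfl⟩
  · intro f
    obtain ⟨w, hw⟩ := Ext.covariant_sequence_exact₃ (ModuleCat.of S A) (sc_exact hg hx hs) 
      (Ext.mk₀ (ModuleCat.ofHom f)) rfl (Subsingleton.elim _ _)
    obtain ⟨f', rfl⟩ := Ext.homEquiv₀.symm.surjective w
    refine ⟨f'.hom, ?_⟩
    have : f' ≫ ModuleCat.ofHom g = ModuleCat.ofHom f := by
      apply Ext.homEquiv₀.symm.injective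
      refine Eq.trans ?_ hw
      exact (Ext.mk₀_comp_mk₀ _ _).symm
    exact congrArg ModuleCat.Hom.hom this

end bass2

section bass3
open Pointwise
variable {S : Type u} [CommRing S] [IsNoetherianRing S] [IsLocalRing S] (D : Type u) [AddCommGroup D] [Module S D] 

variable (S) in
structure Bs (n j : ℕ) (Y : Type u) [AddCommGroup Y] [Module S Y] : Prop where
  fin : Module.Finite S Y
  extD : ∀ i, 0 < i → Subsingleton (Ext (ModuleCat.of S D) (ModuleCat.of S Y) i)
  extB : ∀ i, j < i → Subsingleton (Ext (ModuleCat.of S (D →ₗ[S] Y)) (ModuleCat.of S D) i)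
  surj : ∃ f : D →ₗ[S] Ext (ModuleCat.of S (D →ₗ[S] Y)) (ModuleCat.of S D) j, Function.Surjective f
  kd : ∀ l < n, Subsingleton (Ext (ModuleCat.of S (S ⧸ maximalIdeal S)) (ModuleCat.of S Y) l)
  kn : ¬ Subsingleton (Ext (ModuleCat.of S (S ⧸ maximalIdeal S)) (ModuleCat.of S Y) n)
  nz : ∀ N : ModuleCat.{u} S, (∀ a ∈ Module.annihilator S Y, ∀ z : N, a • z = 0) → 
    ∀ i, (∀ l < i, Subsingleton (Ext N (ModuleCat.of S Y) l)) → 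
      Subsingleton (Ext N (ModuleCat.of S D) (i+j)) → Subsingleton (Ext N (ModuleCat.of S Y) i) 
  dim : Module.supportDim S Y + j = Module.supportDim S D

lemma bs_step {n j : ℕ} (Y : Type u) [AddCommGroup Y] [Module S Y] (h : Bs S D (n+1) j Y) :
    ∃ (Y' : Type u) (_ : AddCommGroup Y') (_ : Module S Y'), Bs S D n (j+1) Y' := by
  have := h.fin
  have h0 := h.kd 0 (by omega)
  obtain ⟨x, hxm, reg⟩ : ∃ x ∈ maximalIdeal S, IsSMulRegular Y x := by
    have : Subsingleton (ModuleCat.of S (S ⧸ maximalIdeal S) ⟶ ModuleCat.of S Y) := 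
      Ext.addEquiv₀.subsingleton_congr.mp h0
    have : Subsingleton ((S ⧸ maximalIdeal S) →ₗ[S] Y) := (ModuleCat.homAddEquiv (M := ModuleCat.of S (S ⧸ maximalIdeal S)) (N := ModuleCat.of S Y)).symm.subsingleton
    obtain ⟨x, mem_ann, hx⟩ := IsSMulRegular.subsingleton_linearMap_iff.mp this
    rw [Ideal.annihilator_quotient] at mem_ann
    exact ⟨x, mem_ann, hx⟩
  have hx : Function.Injective (LinearMap.lsmul S Y x) := reg
  have hg := LinearMap.exact_lsmul_mkQ_smul_top Y x
  have hs : Function.Surjective (x • (⊤ : Submodule S Y)).mkQ := Submodule.mkQ_surjective _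
  have hkx : ∀ n : S ⧸ maximalIdeal S, x • n = 0 := by
    intro n
    obtain ⟨n, rfl⟩ := Ideal.Quotient.mk_surjective n
    exact Ideal.Quotient.eq_zero_iff_mem.2 (Ideal.mul_mem_right _ _ hxm)
  obtain ⟨b1, b2, b3⟩ := hom_seq hx hg hs D (h.extD 1 one_pos)
  have bex := sc_exact b2 b1 b3
  refine ⟨QuotSMulTop x Y, inferInstance, inferInstance, ⟨inferInstance, ?_, ?_, ?_, ?_, ?_, ?_, ?_⟩⟩
  · exact fun i hi => cov3 hx hg hs _ (h.extD i hi) (h.extD (i+1) (by omega))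
  · intro i hi
    exact ext_ss₃ bex (ModuleCat.of S D) (i := i - 1) (by omega) (h.extB i (by omega)) (h.extB (i-1) (by omega))
  · obtain ⟨f, hf⟩ := h.surj
    refine ⟨(bex.extClass.precompOfLinear S _ (add_comm 1 j)).comp f, ?_⟩
    intro z
    obtain ⟨y, hy⟩ := ext_shift_surj bex (ModuleCat.of S D) (add_comm 1 j) (h.extB (j+1) (by omega)) z
    obtain ⟨d, rfl⟩ := hf y
    exact ⟨d, hy⟩
  · exact fun l hl => cov3 hx hg hs _ (h.kd l (by omega)) (h.kd (l+1) (by omega))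
  · exact fun h' => h.kn (cov_kill hx hg hs _ hkx h')
  · intro N hN i hl hD
    have hN1 : ∀ z : N, x • z = 0 := by
      refine hN x ?_
      rw [Module.mem_annihilator]
      intro y
      obtain ⟨y, rfl⟩ := hs y
      refine (_root_.map_smul _ x y).symm.trans ?_
      exact (hg _).2 ⟨y, rfl⟩
    have hN2 : ∀ a ∈ Module.annihilator S Y, ∀ z : N, a • z = 0 := fun a ha => hN a (by
      rw [Module.mem_annihilator] at ha ⊢
      intro y
      obtain ⟨y, rfl⟩ := hs y
      refine (_root_.map_smul _ a y).symm.trans ?_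
      rw [ha, _root_.map_zero])
    have hl' : ∀ l < i + 1, Subsingleton (Ext N (ModuleCat.of S Y) l) := by
      rintro (_ | l) hl1
      · exact cov_kill0 hx N hN1
      · exact cov_kill hx hg hs N hN1 (hl l (by omega))
    refine cov3 hx hg hs N (hl' i (by omega)) (h.nz N hN2 (i+1) hl' ?_)
    rw [show i + 1 + j = i + (j + 1) by omega]
    exact hD
  · rw [← h.dim, ← Module.supportDim_quotSMulTop_succ_eq_supportDim reg hxm]
    push_cast
    rw [add_assoc, add_comm (j : WithBot ℕ∞) 1]

variable {D}

lemma bs_zero (hD : Dz S D) (n : ℕ) 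
  (kd : ∀ l < n, Subsingleton (Ext (ModuleCat.of S (S ⧸ maximalIdeal S)) (ModuleCat.of S D) l))
  (kn : ¬ Subsingleton (Ext (ModuleCat.of S (S ⧸ maximalIdeal S)) (ModuleCat.of S D) n)) : Bs S D n 0 D := by
  let e : S ≃ₗ[S] (D →ₗ[S] D) := LinearEquiv.ofBijective (LinearMap.toSpanSingleton S _ LinearMap.id) hD.hom
  refine ⟨hD.fin, hD.ext, ?_, ?_, kd, kn, fun _ _ _ _ h => h, by simp⟩
  · intro i hi
    refine ext_ss_iso e.toModuleIso (Iso.refl _) i ?_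
    have : Projective (ModuleCat.of S S) := ModuleCat.projective_of_free (Module.Basis.singleton Unit S)
    exact ext_proj _ _ i hi
  · refine ⟨{ toFun := fun d => Ext.mk₀ (ModuleCat.ofHom ((LinearMap.toSpanSingleton S D d).comp e.symm.toLinearMap)), map_add' := ?_, map_smul' := ?_ }, ?_⟩
    · intro a b
      rw [← Ext.mk₀_add]
      congr 1
      apply ModuleCat.hom_ext
      apply LinearMap.ext
      intro x
      exact smul_add _ _ _
    · intro a b
      rw [RingHom.id_apply, ← Ext.mk₀_smul]
      congr 1
      apply ModuleCat.hom_ext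
      apply LinearMap.ext
      intro x
      exact smul_comm _ _ _
    · intro z
      obtain ⟨f, rfl⟩ := Ext.homEquiv₀.symm.surjective z
      refine ⟨f.hom (e 1), ?_⟩
      refine congrArg Ext.homEquiv₀.symm ?_
      apply ModuleCat.hom_ext
      apply LinearMap.ext
      intro x
      obtain ⟨s, rfl⟩ := e.surjective x
      change e.symm (e s) • f.hom (e 1) = f.hom (e s)
      rw [e.symm_apply_apply, ← _root_.map_smul, ← _root_.map_smul, smul_eq_mul, mul_one]

lemma bs_exists (hD : Dz S D) (n : ℕ) 
  (kd : ∀ l < n, Subsingleton (Ext (ModuleCat.of S (S ⧸ maximalIdeal S)) (ModuleCat.of S D) l))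
  (kn : ¬ Subsingleton (Ext (ModuleCat.of S (S ⧸ maximalIdeal S)) (ModuleCat.of S D) n)) :
    ∃ (Y' : Type u) (_ : AddCommGroup Y') (_ : Module S Y'), Bs S D 0 n Y' := by
  suffices ∀ j ≤ n, ∃ (Y' : Type u) (_ : AddCommGroup Y') (_ : Module S Y'), Bs S D (n-j) j Y' by
    simpa using this n le_rfl
  intro j
  induction j with
  | zero => exact fun _ => ⟨D, _, _, bs_zero hD n kd kn⟩
  | succ j ih =>
    intro hj
    obtain ⟨Y, _, _, h⟩ := ih (by omega)
    rw [show n - j = (n - (j+1)) + 1 by omega] at h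
    exact bs_step D Y h
end bass3
end TH
namespace TH
open CategoryTheory Limits Opposite Abelian IsLocalRing
section bass4
variable {S : Type u} [CommRing S] [IsLocalRing S] 

lemma exists_residue_basis (D : Type u) [AddCommGroup D] [Module S D] [Module.Finite S D] : 
    ∃ n, Nonempty ((D ⧸ (maximalIdeal S • ⊤ : Submodule S D)) ≃ₗ[S] (Fin n → S ⧸ maximalIdeal S)) := by
  let _ : Field (S ⧸ maximalIdeal S) := Ideal.Quotient.field _
  have : Module.Finite (S ⧸ maximalIdeal S) (D ⧸ (maximalIdeal S • ⊤ : Submodule S D)) :=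
    Module.Finite.of_restrictScalars_finite S _ _
  exact ⟨_, ⟨(Module.finBasis (S ⧸ maximalIdeal S)
    (D ⧸ (maximalIdeal S • ⊤ : Submodule S D))).equivFun.restrictScalars S⟩⟩

lemma residue_kill {a : S} (ha : a ∈ maximalIdeal S) (n : S ⧸ maximalIdeal S) : a • n = 0 := by
  obtain ⟨n, rfl⟩ := Ideal.Quotient.mk_surjective n
  exact Ideal.Quotient.eq_zero_iff_mem.2 (Ideal.mul_mem_right _ _ ha)

instance residue_simple : IsSimpleModule S (S ⧸ maximalIdeal S) :=
  isSimpleModule_iff_isCoatom.2 (IsLocalRing.maximalIdeal.isMaximal S).out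

variable {D Y : Type u} [AddCommGroup D] [Module S D] [AddCommGroup Y] [Module S Y]

lemma exists_pow_emb {n : ℕ} (ε : D →ₗ[S] (Fin n → S ⧸ maximalIdeal S)) (hε : Function.Surjective ε)
    (ι : (S ⧸ maximalIdeal S) →ₗ[S] Y) (hι : Function.Injective ι) :
    ∃ ψ : (Fin n → S ⧸ maximalIdeal S) →ₗ[S] (D →ₗ[S] Y), Function.Injective ψ := by
  refine ⟨{ toFun := fun c => ι ∘ₗ (∑ i, (LinearMap.mul S (S ⧸ maximalIdeal S) (c i)) ∘ₗ (LinearMap.proj i)) ∘ₗ ε, map_add' := ?_, map_smul' := ?_ }, ?_⟩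
  · intro a b
    ext d
    simp [Finset.sum_add_distrib]
  · intro r a
    ext d
    simp [Finset.smul_sum]
  · rw [injective_iff_map_eq_zero]
    intro c hc
    funext i
    obtain ⟨d, hd⟩ := hε (Pi.single i 1)
    have := congrArg (fun f : D →ₗ[S] Y => f d) hc
    have h2 : ι (∑ j, c j * (ε d) j) = 0 := by simpa using this
    rw [hd] at h2
    have h3 := hι (h2.trans (_root_.map_zero ι).symm)
    simpa [Pi.single_apply] using h3

lemma pow_surj {n : ℕ} (hn : 0 < n) {E : Type u} [AddCommGroup E] [Module S E] (hE : Nontrivial E)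
    (f : (Fin n → S ⧸ maximalIdeal S) →ₗ[S] (Fin n → E)) (hf : Function.Surjective f) :
    IsSimpleModule S E := by
  have h := Module.length_le_of_surjective f hf
  rw [Module.length_pi, Module.length_pi, Module.length_eq_one S (S ⧸ maximalIdeal S), ENat.card_eq_coe_fintype_card,
    Fintype.card_fin] at h
  rw [← Module.length_eq_one_iff]
  have h1 : 0 < Module.length S E := Module.length_pos
  have h2 : Module.length S E ≠ ⊤ := by
    intro ht
    rw [ht, ENat.mul_top (by exact_mod_cast hn.ne'), mul_one] at h
    exact absurd (top_le_iff.1 h) (ENat.natCast_ne_top n)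
  lift Module.length S E to ℕ using h2 with l
  norm_cast at *
  have : l ≤ 1 := by
    rw [mul_one] at h
    exact Nat.le_of_mul_le_mul_left (by simpa using h) hn
  omega

lemma ext_pow_surj {n e : ℕ} (K : Type u) [AddCommGroup K] [Module S K] (Y : ModuleCat.{u} S)  :
    ∃ f : Ext (ModuleCat.of S (Fin n → K)) Y e →ₗ[S] (Fin n → Ext (ModuleCat.of S K) Y e), Function.Surjective f := by
  refine ⟨LinearMap.pi fun i => (Ext.mk₀ (ModuleCat.ofHom (LinearMap.single S (fun _ => K) i))).precompOfLinear S Y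
    (zero_add e), ?_⟩
  intro w
  refine ⟨∑ j, (Ext.mk₀ (ModuleCat.ofHom (LinearMap.proj j))).comp (w j) (zero_add e), ?_⟩
  funext i
  rw [_root_.map_sum, Finset.sum_apply, Finset.sum_eq_single i]
  · change (Ext.mk₀ _).comp ((Ext.mk₀ _).comp (w i) (zero_add e)) (zero_add e) = _
    rw [Ext.mk₀_comp_mk₀_assoc]
    have : ModuleCat.ofHom (LinearMap.single S (fun _ => K) i) ≫ ModuleCat.ofHom (LinearMap.proj i : (Fin n → K) →ₗ[S] K) = 𝟙 _ := by
      rw [← ModuleCat.ofHom_comp, LinearMap.proj_comp_single_same]; rfl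
    rw [this, Ext.mk₀_id_comp]
  · intro j _ hj
    change (Ext.mk₀ _).comp ((Ext.mk₀ _).comp (w j) (zero_add e)) (zero_add e) = _
    rw [Ext.mk₀_comp_mk₀_assoc]
    have : ModuleCat.ofHom (LinearMap.single S (fun _ => K) i) ≫ ModuleCat.ofHom (LinearMap.proj j : (Fin n → K) →ₗ[S] K) = 0 := by
      rw [← ModuleCat.ofHom_comp, LinearMap.proj_comp_single_ne _ _ _ _ hj]; rfl
    rw [this, Ext.mk₀_zero, Ext.zero_comp]
  · simp

variable [IsNoetherianRing S]

structure Bass (S : Type u) [CommRing S] [IsLocalRing S] (D : Type u) [AddCommGroup D] [Module S D]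
    (e : ℕ) : Prop where
  lt : ∀ l < e, Subsingleton (Ext (ModuleCat.of S (S ⧸ maximalIdeal S)) (ModuleCat.of S D) l)
  gt : ∀ i, e < i → ∀ (N : Type u) [AddCommGroup N] [Module S N] [Module.Finite S N],
    Subsingleton (Ext (ModuleCat.of S N) (ModuleCat.of S D) i)
  simple : IsSimpleModule S (Ext (ModuleCat.of S (S ⧸ maximalIdeal S)) (ModuleCat.of S D) e)
  dim : ringKrullDim S = e

lemma ext_ne (hD : Dz S D) : 
    ∃ i, ¬ Subsingleton (Ext (ModuleCat.of S (S ⧸ maximalIdeal S)) (ModuleCat.of S D) i) := by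
  by_contra! hc
  have := hD.fin
  have h := ext_ss_all (ModuleCat.of S D) 0 (fun i _ => hc i) D 0 le_rfl
  have h1 : Subsingleton (ModuleCat.of S D ⟶ ModuleCat.of S D) := 
      Ext.addEquiv₀.subsingleton_congr.mp h
  have h2 : Subsingleton (D →ₗ[S] D) :=
    (ModuleCat.homAddEquiv (M := ModuleCat.of S D) (N := ModuleCat.of S D)).symm.subsingleton
  exact zero_ne_one (hD.hom.1 (Subsingleton.elim _ _))

omit [IsNoetherianRing S] in
lemma dz_nontrivial (hD : Dz S D) : Nontrivial D := by
  by_contra h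
  rw [not_nontrivial_iff_subsingleton] at h
  exact zero_ne_one (hD.hom.1 (Subsingleton.elim _ _))

lemma bass (hD : Dz S D) : ∃ e, Bass S D e := by
  classical
  have hfin := hD.fin
  have hex := ext_ne hD
  let e := Nat.find hex
  have kn := Nat.find_spec hex
  have kd : ∀ l < e, Subsingleton (Ext (ModuleCat.of S (S ⧸ maximalIdeal S)) (ModuleCat.of S D) l) :=
    fun l hl => by simpa using Nat.find_min hex hl
  obtain ⟨Y, _, _, hY⟩ := bs_exists hD e kd kn
  have hYfin := hY.fin
  obtain ⟨ι, hι⟩ : ∃ ι : (S ⧸ maximalIdeal S) →ₗ[S] Y, Function.Injective ι := by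
    have h := hY.kn
    rw [not_subsingleton_iff_nontrivial] at h
    obtain ⟨z, hz⟩ := exists_ne (α := Ext (ModuleCat.of S (S ⧸ maximalIdeal S)) (ModuleCat.of S Y) 0) 0
    obtain ⟨f, rfl⟩ := Ext.homEquiv₀.symm.surjective z
    refine ⟨f.hom, (LinearMap.injective_or_eq_zero f.hom).resolve_right fun h => hz ?_⟩
    have : f = 0 := ModuleCat.hom_ext h
    rw [this]
    exact Ext.mk₀_zero _ _
  obtain ⟨n, ⟨ε⟩⟩ := exists_residue_basis (S := S) D
  have hn : 0 < n := by
    rcases Nat.eq_zero_or_pos n with rfl | h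
    · exfalso
      have h1 : Subsingleton (D ⧸ (maximalIdeal S • ⊤ : Submodule S D)) := ε.toEquiv.subsingleton
      rw [Submodule.Quotient.subsingleton_iff] at h1
      have h2 := Submodule.eq_bot_of_le_smul_of_le_jacobson_bot (maximalIdeal S) ⊤ hfin.fg_top h1.ge
        (jacobson_eq_maximalIdeal ⊥ bot_ne_top).ge
      have := dz_nontrivial hD
      exact top_ne_bot h2
    · exact h
  obtain ⟨ψ, hψ⟩ := exists_pow_emb (ε.toLinearMap.comp (Submodule.mkQ _))
    (ε.surjective.comp (Submodule.mkQ_surjective _)) ι hι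
  have hBfin : Module.Finite S (D →ₗ[S] Y) := inferInstance
  have gtk : ∀ i, e < i → Subsingleton (Ext (ModuleCat.of S (S ⧸ maximalIdeal S)) (ModuleCat.of S D) i) := by
    obtain ⟨b, hb⟩ := hD.bdd
    suffices ∀ t i, e < i → b < i + t →
      Subsingleton (Ext (ModuleCat.of S (S ⧸ maximalIdeal S)) (ModuleCat.of S D) i) from
      fun i hi => this (b+1) i hi (by omega)
    intro t
    induction t with
    | zero => exact fun i _ hi => hb i hi
    | succ t ih =>
      intro i hi hib
      let ψ' := ψ.comp (LinearMap.single S (fun _ => S ⧸ maximalIdeal S) (⟨0, hn⟩ : Fin n))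
      have hψ' : Function.Injective ψ' := hψ.comp (fun a b hab => by
        simpa using congrFun hab (⟨0, hn⟩ : Fin n))
      have ex := sc_exact (LinearMap.exact_map_mkQ_range ψ') hψ' (Submodule.mkQ_surjective _)
      exact ext_ss₁ ex (ModuleCat.of S D) (add_comm 1 i) (hY.extB i hi)
        (ext_ss_all (ModuleCat.of S D) (i+1) (fun c hc => ih c (by omega) (by omega)) _ (i+1) le_rfl)
  have gt : ∀ i, e < i → ∀ (N : Type u) [AddCommGroup N] [Module S N] [Module.Finite S N],
      Subsingleton (Ext (ModuleCat.of S N) (ModuleCat.of S D) i) := fun i hi N _ _ _ =>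
    ext_ss_all (ModuleCat.of S D) (e+1) (fun c hc => gtk c hc) N i hi
  refine ⟨e, kd, gt, ?_, ?_⟩
  · obtain ⟨f, hf⟩ := hY.surj
    have ex := sc_exact (LinearMap.exact_map_mkQ_range ψ) hψ (Submodule.mkQ_surjective _)
    obtain ⟨g, hg⟩ := ext_pow_surj (n := n) (e := e) (S ⧸ maximalIdeal S) (ModuleCat.of S D)
    have hsurj : Function.Surjective ((Ext.mk₀ (ModuleCat.ofHom ψ)).precompOfLinear S (ModuleCat.of S D)
        (zero_add e)) := by
      intro z
      exact Ext.contravariant_sequence_exact₁ ex (ModuleCat.of S D) z (add_comm 1 e)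
        ((gt (e+1) (by omega) _).elim _ _)
    let G := g.comp (((Ext.mk₀ (ModuleCat.ofHom ψ)).precompOfLinear S (ModuleCat.of S D)
        (zero_add e)).comp f)
    have hG : Function.Surjective G := hg.comp (hsurj.comp hf)
    have hker : (maximalIdeal S • ⊤ : Submodule S D) ≤ LinearMap.ker G := by
      rw [Submodule.smul_le]
      intro a ha d _
      rw [LinearMap.mem_ker, _root_.map_smul]
      funext i
      exact ext_smul_zero (residue_kill ha) (G d i)
    refine pow_surj hn (not_subsingleton_iff_nontrivial.1 kn)
      ((Submodule.liftQ _ G hker).comp ε.symm.toLinearMap) ?_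
    refine Function.Surjective.comp (g := Submodule.liftQ _ G hker) ?_ ε.symm.surjective
    intro z
    obtain ⟨d, rfl⟩ := hG z
    exact ⟨Submodule.Quotient.mk d, rfl⟩
  · have hass : ∀ q ∈ associatedPrimes S Y, q = maximalIdeal S := by
      intro q hq
      obtain ⟨hqp, f, hf⟩ := (isAssociatedPrime_iff_exists_injective_linearMap _ _).1 hq
      by_contra hqm
      obtain ⟨x, hxm, hxq⟩ := SetLike.exists_of_lt (lt_of_le_of_ne (le_maximalIdeal hqp.ne_top) hqm)
      have h1 := ext_ss_of_lsmul (ModuleCat.of S D) (i := e) hxm (lsmul_inj ⟨q, hqp⟩ hxq) (gt (e+1) (by omega) _)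
      have h2 := hY.nz (ModuleCat.of S (S ⧸ q)) (fun a ha z => hf (by
        rw [_root_.map_smul, _root_.map_zero]
        exact Module.mem_annihilator.1 ha _)) 0 (fun l hl => absurd hl (by omega)) (by rw [zero_add]; exact h1)
      have h3 : Ext.homEquiv₀.symm (ModuleCat.ofHom f) = Ext.homEquiv₀.symm 0 := h2.elim _ _
      have h4 := congrArg ModuleCat.Hom.hom (Ext.homEquiv₀.symm.injective h3)
      have h5 : f 1 = 0 := congrArg (fun f : (S ⧸ q) →ₗ[S] Y => f 1) h4
      have h6 := hf (h5.trans (_root_.map_zero f).symm)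
      exact hqp.ne_top (Ideal.Quotient.subsingleton_iff.1 (subsingleton_of_zero_eq_one h6.symm))
    have hYnt : Nontrivial Y := hι.nontrivial
    have hsd : Module.supportDim S Y = 0 := by
      have h1 : Nonempty (Module.support S Y) := Module.nonempty_support_of_nontrivial.to_subtype
      have h2 : Subsingleton (Module.support S Y) := by
        suffices ∀ q ∈ Module.support S Y, q.asIdeal = maximalIdeal S from
          ⟨fun a b => Subtype.ext (PrimeSpectrum.ext ((this a a.2).trans (this b b.2).symm))⟩
        intro q hq
        rw [Module.mem_support_iff_of_finite] at hq
        obtain ⟨q', hq', hle⟩ := Ideal.exists_minimalPrimes_le hq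
        have := hass q' (Module.associatedPrimes.minimalPrimes_annihilator_subset_associatedPrimes S Y hq')
        rw [this] at hle
        exact le_antisymm (le_maximalIdeal q.2.ne_top) hle
      exact Order.krullDim_eq_zero
    have hd := hY.dim
    rw [hsd, zero_add] at hd
    have hann : Module.annihilator S D = ⊥ := by
      rw [eq_bot_iff]
      intro a ha
      refine hD.hom.1 ?_
      ext d
      simpa using Module.mem_annihilator.1 ha d
    rw [hd, Module.supportDim_eq_ringKrullDim_quotient_annihilator, hann]
    exact (RingEquiv.ringKrullDim (RingEquiv.quotientBot S)).symm

end bass4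
end TH
namespace TH
open CategoryTheory Limits Opposite Abelian IsLocalRing
set_option linter.unusedSectionVars false
section pb
variable {S : Type u} [CommRing S] {A B C : Type u} [AddCommGroup A] [AddCommGroup B]
  [AddCommGroup C] [Module S A] [Module S B] [Module S C] {Y : ModuleCat.{u} S} {e : ℕ}

noncomputable def pb (f : A →ₗ[S] B) (Y : ModuleCat.{u} S) (e : ℕ) :
    Ext (ModuleCat.of S B) Y e →ₗ[S] Ext (ModuleCat.of S A) Y e :=
  (Ext.mk₀ (ModuleCat.ofHom f)).precompOfLinear S Y (zero_add e)

lemma pb_apply (f : A →ₗ[S] B) (ξ : Ext (ModuleCat.of S B) Y e) :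
    pb f Y e ξ = (Ext.mk₀ (ModuleCat.ofHom f)).comp ξ (zero_add e) := rfl

lemma pb_comp (f : A →ₗ[S] B) (g : B →ₗ[S] C) (ξ : Ext (ModuleCat.of S C) Y e) :
    pb f Y e (pb g Y e ξ) = pb (g ∘ₗ f) Y e ξ := by
  simp only [pb_apply]
  rw [Ext.mk₀_comp_mk₀_assoc]; rfl

lemma pb_id (ξ : Ext (ModuleCat.of S A) Y e) : pb LinearMap.id Y e ξ = ξ := by
  simp only [pb_apply]
  exact Ext.mk₀_id_comp ξ

lemma pb_zero (ξ : Ext (ModuleCat.of S B) Y e) : pb (0 : A →ₗ[S] B) Y e ξ = 0 := by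
  simp only [pb_apply]
  rw [ModuleCat.ofHom_zero, Ext.mk₀_zero, Ext.zero_comp]

lemma pb_add (f g : A →ₗ[S] B) (ξ : Ext (ModuleCat.of S B) Y e) :
    pb (f + g) Y e ξ = pb f Y e ξ + pb g Y e ξ := by
  simp only [pb_apply]
  rw [ModuleCat.ofHom_add, Ext.mk₀_add, Ext.add_comp]

lemma pb_smul (a : S) (f : A →ₗ[S] B) (ξ : Ext (ModuleCat.of S B) Y e) :
    pb (a • f) Y e ξ = a • pb f Y e ξ := by
  simp only [pb_apply]
  rw [← Ext.smul_comp, ← Ext.mk₀_smul]; rfl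

lemma pb_sum {ι : Type*} (s : Finset ι) (f : ι → A →ₗ[S] B) (ξ : Ext (ModuleCat.of S B) Y e) :
    pb (∑ i ∈ s, f i) Y e ξ = ∑ i ∈ s, pb (f i) Y e ξ := by
  classical
  induction s using Finset.induction_on with
  | empty => simp [pb_zero]
  | insert a s ha ih => rw [Finset.sum_insert ha, Finset.sum_insert ha, pb_add, ih]

lemma pb_mid {f : A →ₗ[S] B} {g : B →ₗ[S] C} (h : Function.Exact f g) (hf : Function.Injective f)
    (hg : Function.Surjective g) (ξ : Ext (ModuleCat.of S B) Y e) (hξ : pb f Y e ξ = 0) :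
    ∃ η, pb g Y e η = ξ :=
  Ext.contravariant_sequence_exact₂ (sc_exact h hf hg) Y ξ hξ

lemma pb_inj {g : B →ₗ[S] C} (hg : Function.Surjective g)
    (h : ∀ l, l + 1 = e → Subsingleton (Ext (ModuleCat.of S (LinearMap.ker g)) Y l))
    (ξ : Ext (ModuleCat.of S C) Y e) (hξ : pb g Y e ξ = 0) : ξ = 0 := by
  have hse := sc_exact (LinearMap.exact_subtype_ker_map g) (Submodule.subtype_injective _) hg
  obtain _ | l := e
  · obtain ⟨φ, rfl⟩ := Ext.homEquiv₀.symm.surjective ξ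
    have : Epi (ModuleCat.ofHom g) := (ModuleCat.epi_iff_surjective _).2 hg
    have h1 : Ext.mk₀ (ModuleCat.ofHom g ≫ φ) = 0 := by
      rw [← Ext.mk₀_comp_mk₀]; exact hξ
    have h2 : ModuleCat.ofHom g ≫ φ = 0 := Ext.homEquiv₀.symm.injective (by
      refine h1.trans (Ext.mk₀_zero _ _).symm)
    have h3 : φ = 0 := by
      rw [← cancel_epi (ModuleCat.ofHom g), h2, comp_zero]
    rw [h3]; exact Ext.mk₀_zero _ _
  · obtain ⟨x, rfl⟩ := Ext.contravariant_sequence_exact₃ hse Y ξ hξ (add_comm 1 l)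
    have := h l rfl
    rw [Subsingleton.elim x 0, Ext.comp_zero]

lemma pb_surj {f : A →ₗ[S] B} (hf : Function.Injective f)
    (h : Subsingleton (Ext (ModuleCat.of S (B ⧸ LinearMap.range f)) Y (e + 1)))
    (ξ : Ext (ModuleCat.of S A) Y e) : ∃ η, pb f Y e η = ξ := by
  have hse := sc_exact (LinearMap.exact_map_mkQ_range f) hf (Submodule.mkQ_surjective _)
  exact Ext.contravariant_sequence_exact₁ hse Y ξ (add_comm 1 e) (Subsingleton.elim _ _)

end pb

section lin
variable {S : Type u} [CommRing S] [IsNoetherianRing S] {m : Ideal S} {t : ℕ} {N N' : Type u} [AddCommGroup N] [Module S N]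
   [AddCommGroup N'] [Module S N']

def Kil (m : Ideal S) (t : ℕ) (N : Type u) [AddCommGroup N] [Module S N] : Prop :=
  ∀ a ∈ m ^ t, ∀ n : N, a • n = 0

noncomputable def lin (hN : Kil m t N) (n : N) : (S ⧸ m ^ t) →ₗ[S] N :=
  Submodule.liftQ (m ^ t) (LinearMap.toSpanSingleton S N n) (fun a ha => hN a ha n)

lemma lin_mk (hN : Kil m t N) (n : N) (a : S) : lin hN n (Ideal.Quotient.mk _ a) = a • n := rfl

lemma kil_quot : Kil m t (S ⧸ m ^ t) := fun _ ha y => quot_pow_kill ha y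

lemma kil_sub (hN : Kil m t N) (f : N' →ₗ[S] N) (hf : Function.Injective f) : Kil m t N' := by
  intro a ha n
  apply hf
  rw [_root_.map_smul, hN a ha, _root_.map_zero]

lemma lin_ext {f g : (S ⧸ m ^ t) →ₗ[S] N} (h : f 1 = g 1) : f = g := by
  apply LinearMap.ext
  intro x
  obtain ⟨a, rfl⟩ := Ideal.Quotient.mk_surjective x
  have : (Ideal.Quotient.mk (m ^ t) a) = a • (1 : S ⧸ m ^ t) := by
    rw [Algebra.smul_def, mul_one]; rfl
  rw [this, _root_.map_smul, _root_.map_smul, h]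

lemma lin_one (hN : Kil m t N) (n : N) : lin hN n 1 = n := by
  have := lin_mk hN n 1
  rwa [one_smul, _root_.map_one] at this

lemma comp_lin (hN : Kil m t N) (hN' : Kil m t N') (f : N →ₗ[S] N') (n : N) :
    f ∘ₗ lin hN n = lin hN' (f n) := by
  apply lin_ext
  rw [LinearMap.comp_apply, lin_one, lin_one]

lemma lin_add (hN : Kil m t N) (n n' : N) : lin hN (n + n') = lin hN n + lin hN n' := by
  apply lin_ext
  rw [LinearMap.add_apply, lin_one, lin_one, lin_one]

lemma lin_smul (hN : Kil m t N) (a : S) (n : N) : lin hN (a • n) = a • lin hN n := by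
  apply lin_ext
  rw [LinearMap.smul_apply, lin_one, lin_one]

noncomputable def cov (hN : Kil m t N) {b : ℕ} (n : Fin b → N) : (Fin b → S ⧸ m ^ t) →ₗ[S] N :=
  ∑ i, lin hN (n i) ∘ₗ (LinearMap.proj i : (Fin b → S ⧸ m ^ t) →ₗ[S] _)

lemma kil_pi {b : ℕ} : Kil m t (Fin b → S ⧸ m ^ t) := by
  intro a ha n
  funext i
  exact quot_pow_kill ha _

lemma cover (hN : Kil m t N) [Module.Finite S N] : ∃ b : ℕ, ∃ n : Fin b → N,
    Function.Surjective (cov hN n) := by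
  obtain ⟨b, f, hf⟩ := Module.Finite.exists_fin' S N
  refine ⟨b, fun i => f (Pi.single i 1), fun y => ?_⟩
  obtain ⟨c, rfl⟩ := hf y
  refine ⟨fun i => Ideal.Quotient.mk _ (c i), ?_⟩
  rw [cov, LinearMap.sum_apply, LinearMap.pi_apply_eq_sum_univ f c]
  refine Finset.sum_congr rfl fun i _ => ?_
  refine (lin_mk hN _ _).trans ?_
  congr 2
  ext j
  simp [Pi.single_apply, eq_comm]

end lin

section H
variable {S : Type u} [CommRing S] [IsLocalRing S] [IsNoetherianRing S] {D : Type u} [AddCommGroup D] [Module S D]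
  {e : ℕ} (hB : Bass S D e) {t : ℕ} {N N' : Type u} [AddCommGroup N] [Module S N]
   [AddCommGroup N'] [Module S N']
include hB

lemma ext_lt [Module.Finite S N] (hN : Kil (maximalIdeal S) t N) {l : ℕ} (hl : l < e) :
    Subsingleton (Ext (ModuleCat.of S N) (ModuleCat.of S D) l) := by
  refine ext_ss_of_supp _ _ N inferInstance fun q hq => ?_
  have hq' := (Module.mem_support_iff_of_finite).1 hq
  have h2 : maximalIdeal S ^ t ≤ q.asIdeal := by
    refine le_trans (fun a ha => ?_) hq'
    rw [Module.mem_annihilator]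
    exact hN a ha
  have h3 : q.asIdeal = maximalIdeal S :=
    ((IsLocalRing.maximalIdeal.isMaximal S).eq_of_le q.isPrime.ne_top (q.isPrime.le_of_pow_le h2)).symm
  rw [h3]
  exact hB.lt l hl

lemma T_inj [Module.Finite S N] (hN : Kil (maximalIdeal S) t N) {g : N →ₗ[S] N'}
    (hg : Function.Surjective g) (ξ : Ext (ModuleCat.of S N') (ModuleCat.of S D) e)
    (hξ : pb g _ e ξ = 0) : ξ = 0 := by
  refine pb_inj hg (fun l hl => ?_) ξ hξ
  exact ext_lt hB (kil_sub hN (LinearMap.ker g).subtype (Submodule.subtype_injective _)) (by omega)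

lemma T_surj [Module.Finite S N'] {f : N →ₗ[S] N'}
    (hf : Function.Injective f) (ξ : Ext (ModuleCat.of S N) (ModuleCat.of S D) e) :
    ∃ η, pb f _ e η = ξ :=
  pb_surj hf (hB.gt _ (Nat.lt_succ_self e) _) ξ

lemma theta_inj [Module.Finite S N] (hN : Kil (maximalIdeal S) t N)
    (ξ : Ext (ModuleCat.of S N) (ModuleCat.of S D) e) (hξ : ∀ n, pb (lin hN n) _ e ξ = 0) : ξ = 0 := by
  obtain ⟨b, n, hs⟩ := cover hN
  refine T_inj (t := t) hB kil_pi hs ξ ?_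
  rw [cov, pb_sum]
  refine Finset.sum_eq_zero fun i _ => ?_
  rw [← pb_comp, hξ, _root_.map_zero]

omit hB in
lemma pb_lin_mk (a : S) (ξ : Ext (Sm (maximalIdeal S) t) (ModuleCat.of S D) e) :
    pb (lin (kil_quot (m := maximalIdeal S)) (Ideal.Quotient.mk (maximalIdeal S ^ t) a)) (ModuleCat.of S D) e ξ = a • ξ := by
  have : lin (kil_quot (m := maximalIdeal S)) (Ideal.Quotient.mk (maximalIdeal S ^ t) a) = a • LinearMap.id := by
    apply lin_ext
    rw [lin_one, LinearMap.smul_apply, LinearMap.id_apply, Algebra.smul_def, mul_one]; rfl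
  rw [this, pb_smul, pb_id]

omit hB in
lemma T_kill {a : S} (ha : a ∈ maximalIdeal S ^ t) (ξ : Ext (Sm (maximalIdeal S) t) (ModuleCat.of S D) e) :
    a • ξ = 0 := by
  rw [← pb_lin_mk, Ideal.Quotient.eq_zero_iff_mem.2 ha]
  have : lin (kil_quot (m := maximalIdeal S) (t := t)) 0 = 0 := by
    apply lin_ext
    rw [lin_one, LinearMap.zero_apply]
  rw [this, pb_zero]

lemma of_inj {x : Ext (Sm (maximalIdeal S) t) (ModuleCat.of S D) e}
    (hx : F.of (maximalIdeal S) e (ModuleCat.of S D) t x = 0) : x = 0 := by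
  obtain ⟨s, h, hs⟩ := F.of_eq_zero.1 hx
  refine T_inj hB (kil_quot (m := maximalIdeal S) (t := s)) (g := (qm (maximalIdeal S) h).hom) ?_ x hs
  intro y
  obtain ⟨a, rfl⟩ := Ideal.Quotient.mk_surjective y
  exact ⟨Ideal.Quotient.mk _ a, rfl⟩

lemma H_tors (z : F (maximalIdeal S) e (ModuleCat.of S D)) (hz : ∀ a ∈ maximalIdeal S ^ t, a • z = 0) :
    ∃ x, F.of (maximalIdeal S) e (ModuleCat.of S D) t x = z := by
  obtain ⟨s, hs, x, rfl⟩ := F.exists_of_ge z t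
  have hx : ∀ a ∈ maximalIdeal S ^ t, a • x = 0 := fun a ha => of_inj hB (by
    rw [_root_.map_smul, hz a ha])
  have hsu : Function.Surjective (qm (maximalIdeal S) hs).hom := by
    intro y
    obtain ⟨a, rfl⟩ := Ideal.Quotient.mk_surjective y
    exact ⟨Ideal.Quotient.mk _ a, rfl⟩
  have hK : Kil (maximalIdeal S) s (LinearMap.ker (qm (maximalIdeal S) hs).hom) :=
    kil_sub kil_quot _ (Submodule.subtype_injective _)
  obtain ⟨η, hη⟩ := pb_mid (LinearMap.exact_subtype_ker_map (qm (maximalIdeal S) hs).hom)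
    (Submodule.subtype_injective _) hsu x (by
      refine theta_inj hB hK _ fun k => ?_
      rw [pb_comp, comp_lin hK kil_quot]
      obtain ⟨k, hk⟩ := k
      obtain ⟨a, rfl⟩ := Ideal.Quotient.mk_surjective k
      refine (pb_lin_mk a x).trans (hx a ?_)
      exact Ideal.Quotient.eq_zero_iff_mem.1 hk)
  refine ⟨η, ?_⟩
  rw [← hη]
  exact (F.of_tr hs η).symm

lemma theta_surj [Module.Finite S N] (hN : Kil (maximalIdeal S) t N)
    (φ : N →ₗ[S] F (maximalIdeal S) e (ModuleCat.of S D)) :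
    ∃ ξ : Ext (ModuleCat.of S N) (ModuleCat.of S D) e,
      ∀ n, F.of (maximalIdeal S) e (ModuleCat.of S D) t (pb (lin hN n) _ e ξ) = φ n := by
  obtain ⟨b, n, hs⟩ := cover hN
  have h1 : ∀ i, ∃ c, F.of (maximalIdeal S) e (ModuleCat.of S D) t c = φ (n i) := fun i =>
    H_tors hB _ (fun a ha => by rw [← _root_.map_smul, hN a ha, _root_.map_zero])
  choose c hc using h1
  let ξ0 : Ext (ModuleCat.of S (Fin b → S ⧸ maximalIdeal S ^ t)) (ModuleCat.of S D) e :=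
    ∑ i, pb (LinearMap.proj i : (Fin b → S ⧸ maximalIdeal S ^ t) →ₗ[S] _) _ e (c i)
  have h2 : ∀ v, F.of (maximalIdeal S) e (ModuleCat.of S D) t (pb (lin kil_pi v) _ e ξ0)
      = φ (cov hN n v) := by
    intro v
    rw [_root_.map_sum, _root_.map_sum, cov, LinearMap.sum_apply, _root_.map_sum]
    refine Finset.sum_congr rfl fun i _ => ?_
    rw [pb_comp, comp_lin kil_pi kil_quot, LinearMap.comp_apply]
    have h3 : ∀ y : S ⧸ maximalIdeal S ^ t, F.of (maximalIdeal S) e (ModuleCat.of S D) t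
        (pb (lin kil_quot y) _ e (c i)) = φ (lin hN (n i) y) := by
      intro y
      obtain ⟨a, rfl⟩ := Ideal.Quotient.mk_surjective y
      rw [lin_mk, _root_.map_smul, ← hc, ← _root_.map_smul]
      exact congrArg _ (pb_lin_mk a (c i))
    exact h3 _
  obtain ⟨ξ, hξ⟩ := pb_mid (LinearMap.exact_subtype_ker_map (cov hN n))
    (Submodule.subtype_injective _) hs ξ0 (by
      refine theta_inj hB (kil_sub kil_pi _ (Submodule.subtype_injective _)) _ fun k => ?_
      rw [pb_comp, comp_lin _ kil_pi]
      apply of_inj hB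
      refine (h2 _).trans ?_
      rw [show cov hN n ((LinearMap.ker (cov hN n)).subtype k) = 0 from k.2, _root_.map_zero])
  refine ⟨ξ, fun n' => ?_⟩
  obtain ⟨v, rfl⟩ := hs n'
  rw [← h2, ← hξ, pb_comp, comp_lin kil_pi hN]

lemma H_inj : Module.Injective S (F (maximalIdeal S) e (ModuleCat.of S D)) := by
  refine baer_torsion (m := maximalIdeal S) _ F.torsion fun t N f => ?_
  have hN : Kil (maximalIdeal S) t N := kil_sub kil_quot N.subtype (Submodule.subtype_injective _)
  obtain ⟨ξ, hξ⟩ := theta_surj hB hN f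
  obtain ⟨ξ', rfl⟩ := T_surj hB (Submodule.subtype_injective N) ξ
  refine ⟨Submodule.liftQ (maximalIdeal S ^ t) (LinearMap.toSpanSingleton S _
    (F.of (maximalIdeal S) e (ModuleCat.of S D) t ξ')) (fun a ha => ?_), fun n => ?_⟩
  · rw [LinearMap.mem_ker, LinearMap.toSpanSingleton_apply, ← _root_.map_smul, T_kill ha, _root_.map_zero]
  · rw [← hξ, pb_comp, comp_lin hN kil_quot]
    obtain ⟨n, hn⟩ := n
    obtain ⟨a, rfl⟩ := Ideal.Quotient.mk_surjective n
    refine Eq.trans ?_ (congrArg _ (pb_lin_mk a ξ').symm)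
    rw [_root_.map_smul]
    rfl

lemma socle : ∃ z : F (maximalIdeal S) e (ModuleCat.of S D), z ≠ 0 ∧ (∀ a ∈ maximalIdeal S, a • z = 0) ∧
    ∀ w : F (maximalIdeal S) e (ModuleCat.of S D), w ≠ 0 → ∃ s : S, s • w = z := by
  let ε : (S ⧸ maximalIdeal S) ≃ₗ[S] (S ⧸ maximalIdeal S ^ 1) :=
    Submodule.quotEquivOfEq _ _ (pow_one _).symm
  have hε : ∀ x : Ext (Sm (maximalIdeal S) 1) (ModuleCat.of S D) e,
     pb ε.symm.toLinearMap _ e (pb ε.toLinearMap _ e x) = x := by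
    intro x
    rw [pb_comp, LinearEquiv.comp_symm]
    exact pb_id x
  have hε' : ∀ x : Ext (ModuleCat.of S (S ⧸ maximalIdeal S)) (ModuleCat.of S D) e,
     pb ε.toLinearMap _ e (pb ε.symm.toLinearMap _ e x) = x := by
    intro x
    rw [pb_comp, LinearEquiv.symm_comp]
    exact pb_id x
  have hsim := hB.simple
  have := hsim.nontrivial
  obtain ⟨y, hy⟩ := exists_ne (0 : Ext (ModuleCat.of S (S ⧸ maximalIdeal S)) (ModuleCat.of S D) e)
  refine ⟨F.of (maximalIdeal S) e (ModuleCat.of S D) 1 (pb ε.symm.toLinearMap _ e y), fun h => ?_, fun a ha => ?_, fun w hw => ?_⟩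
  · have := of_inj hB h
    apply hy
    rw [← hε' y, this, _root_.map_zero]
  · rw [← _root_.map_smul, T_kill (by rwa [pow_one]), _root_.map_zero]
  · obtain ⟨a, ha0, ha⟩ : ∃ a : S, a • w ≠ 0 ∧ ∀ b ∈ maximalIdeal S, b • a • w = 0 := by
      classical
      have hex := F.torsion w
      obtain ⟨t, ht⟩ : ∃ t, Nat.find hex = t + 1 := Nat.exists_eq_succ_of_ne_zero (fun h0 => hw (by
        have := Nat.find_spec hex
        rw [h0] at this
        simpa using this 1 (by simp)))
      have h1 := Nat.find_min hex (m := t) (by omega)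
      have h2 := Nat.find_spec hex
      rw [ht] at h2
      push Not at h1
      obtain ⟨a, ha, ha0⟩ := h1
      refine ⟨a, ha0, fun b hb => ?_⟩
      rw [← mul_smul]
      apply h2
      rw [pow_succ']
      exact Ideal.mul_mem_mul hb ha
    obtain ⟨x, hx⟩ := H_tors hB (t := 1) (a • w) (by rwa [pow_one])
    have hx0 : pb ε.toLinearMap _ e x ≠ 0 := by
      intro h
      apply ha0
      rw [← hx, ← hε x, h, _root_.map_zero, _root_.map_zero]
    have := IsSimpleModule.span_singleton_eq_top S hx0
    obtain ⟨r, hr⟩ := Submodule.mem_span_singleton.1 (this ▸ Submodule.mem_top (x := y))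
    refine ⟨r * a, ?_⟩
    rw [mul_smul, ← hx, ← hr, _root_.map_smul, _root_.map_smul, hε]

end H
end TH
namespace TH
open CategoryTheory Limits Opposite Abelian IsLocalRing
set_option linter.unusedSectionVars false
attribute [local irreducible] F.map F.del F.act F.of instAddCommGroupF instModuleF
section lam
variable {S : Type u} [CommRing S] (m : Ideal S) (D : Type u) [AddCommGroup D] [Module S D] (e : ℕ)
  {N N' : Type u} [AddCommGroup N] [Module S N] [AddCommGroup N'] [Module S N']

noncomputable def lam (N : Type u) [AddCommGroup N] [Module S N] :
    F m e (ModuleCat.of S (N →ₗ[S] D)) →ₗ[S] (N →ₗ[S] F m e (ModuleCat.of S D)) where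
  toFun x :=
    { toFun := fun n => F.map m e (ModuleCat.ofHom (LinearMap.applyₗ n)) x
      map_add' := fun n n' => by
        rw [_root_.map_add, ModuleCat.ofHom_add, F.map_add]
      map_smul' := fun r n => by
        rw [_root_.map_smul]
        exact F.map_smul r _ x }
  map_add' x y := by
    ext n
    exact (F.map m e (ModuleCat.ofHom (LinearMap.applyₗ n))).map_add x y
  map_smul' r x := by
    ext n
    exact (F.map m e (ModuleCat.ofHom (LinearMap.applyₗ n))).map_smul r x

lemma lam_apply (x : F m e (ModuleCat.of S (N →ₗ[S] D))) (n : N) :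
    lam m D e N x n = F.map m e (ModuleCat.ofHom (LinearMap.applyₗ n)) x := rfl

lemma lam_nat (f : N →ₗ[S] N') (x : F m e (ModuleCat.of S (N' →ₗ[S] D))) (n : N) :
    lam m D e N (F.map m e (ModuleCat.ofHom (LinearMap.lcomp S D f)) x) n = lam m D e N' x (f n) := by
  rw [lam_apply, lam_apply, ← F.map_comp]
  rfl

noncomputable def sg {b : ℕ} (i : Fin b) : D →ₗ[S] ((Fin b → S) →ₗ[S] D) :=
  LinearMap.smulRightₗ (LinearMap.proj i)

lemma sg_decomp {b : ℕ} {i : ℕ} (x : F m i (ModuleCat.of S ((Fin b → S) →ₗ[S] D))) :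
    ∑ j, F.map m i (ModuleCat.ofHom (sg D j))
      (F.map m i (ModuleCat.ofHom (LinearMap.applyₗ (Pi.single j 1 : Fin b → S))) x) = x := by
  simp_rw [← F.map_comp]
  rw [← F.map_sum]
  refine Eq.trans ?_ (F.map_id x)
  congr 2
  apply ModuleCat.hom_ext
  apply LinearMap.ext
  intro f
  rw [ModuleCat.hom_sum, LinearMap.sum_apply]
  apply LinearMap.ext
  intro v
  rw [LinearMap.sum_apply]
  refine Eq.trans ?_ (LinearMap.pi_apply_eq_sum_univ f v).symm
  refine Finset.sum_congr rfl fun j _ => ?_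
  simp [sg]
  congr 2
  ext k
  simp [Pi.single_apply, eq_comm]

lemma lam_free_inj {b : ℕ} (x : F m e (ModuleCat.of S ((Fin b → S) →ₗ[S] D)))
    (hx : lam m D e _ x = 0) : x = 0 := by
  rw [← sg_decomp m D x]
  refine Finset.sum_eq_zero fun j _ => ?_
  rw [← lam_apply, hx, LinearMap.zero_apply, _root_.map_zero]

lemma lam_free_surj {b : ℕ} (φ : (Fin b → S) →ₗ[S] F m e (ModuleCat.of S D)) :
    ∃ x, lam m D e _ x = φ := by
  refine ⟨∑ j, F.map m e (ModuleCat.ofHom (sg D j)) (φ (Pi.single j 1)), ?_⟩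
  apply LinearMap.ext
  intro v
  rw [_root_.map_sum, LinearMap.sum_apply, LinearMap.pi_apply_eq_sum_univ φ v]
  refine Finset.sum_congr rfl fun j _ => ?_
  rw [lam_apply, ← F.map_comp]
  have : ModuleCat.ofHom (sg D j) ≫ ModuleCat.ofHom (LinearMap.applyₗ v) = v j • 𝟙 (ModuleCat.of S D) := by
    apply ModuleCat.hom_ext
    apply LinearMap.ext
    intro d
    simp [sg]
  rw [this, F.map_smul, F.map_id]
  congr 2
  ext k
  simp [Pi.single_apply, eq_comm]

lemma free_ss {b i : ℕ} (h : Subsingleton (F m i (ModuleCat.of S D))) :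
    Subsingleton (F m i (ModuleCat.of S ((Fin b → S) →ₗ[S] D))) := by
  refine subsingleton_of_forall_eq 0 fun x => ?_
  rw [← sg_decomp m D x]
  refine Finset.sum_eq_zero fun j _ => ?_
  rw [Subsingleton.elim (F.map m i _ x) 0, _root_.map_zero]

lemma dual_seq {A B C : Type u} [AddCommGroup A] [AddCommGroup B]
    [AddCommGroup C] [Module S A] [Module S B] [Module S C] {f : A →ₗ[S] B} {g : B →ₗ[S] C}
    (h : Function.Exact f g) (hf : Function.Injective f) (hg : Function.Surjective g)
    (h1 : Subsingleton (Ext (ModuleCat.of S C) (ModuleCat.of S D) 1)) :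
    ∃ h : Function.Exact (LinearMap.lcomp S D g) (LinearMap.lcomp S D f),
      (sc _ _ h).ShortExact := by
  have he : Function.Exact (LinearMap.lcomp S D g) (LinearMap.lcomp S D f) := by
    intro φ
    constructor
    · intro h0
      have hk : LinearMap.ker g ≤ LinearMap.ker φ := by
        intro x hx
        obtain ⟨a, rfl⟩ := (h x).1 hx
        exact congrArg (fun φ : A →ₗ[S] D => φ a) h0
      refine ⟨(Submodule.liftQ _ φ hk) ∘ₗ (g.quotKerEquivOfSurjective hg).symm.toLinearMap, ?_⟩
      apply LinearMap.ext
      intro x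
      have : (g.quotKerEquivOfSurjective hg).symm (g x) = Submodule.Quotient.mk x := by
        rw [LinearEquiv.symm_apply_eq]; rfl
      exact congrArg (Submodule.liftQ _ φ hk) this
    · rintro ⟨ψ, rfl⟩
      ext a
      exact (congrArg ψ (h.apply_apply_eq_zero a)).trans (_root_.map_zero ψ)
  refine ⟨he, sc_exact he ?_ ?_⟩
  · intro φ ψ hh
    apply LinearMap.ext
    intro c
    obtain ⟨b, rfl⟩ := hg c
    exact congrArg (fun φ : B →ₗ[S] D => φ b) hh
  · intro φ
    obtain ⟨y, hy⟩ := Ext.contravariant_sequence_exact₁ (sc_exact h hf hg) (ModuleCat.of S D)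
      (Ext.mk₀ (ModuleCat.ofHom φ)) (add_zero 1) (Subsingleton.elim _ _)
    obtain ⟨ψ, rfl⟩ := Ext.homEquiv₀.symm.surjective y
    refine ⟨ψ.hom, ?_⟩
    have h2 := hy
    erw [Ext.mk₀_comp_mk₀] at h2
    have h3 := Ext.homEquiv₀.symm.injective h2
    exact congrArg ModuleCat.Hom.hom h3

lemma F.inj_of {m : Ideal S} {e : ℕ} {T : ShortComplex (ModuleCat.{u} S)} (hT : T.ShortExact)
    (hC : ∀ i < e, Subsingleton (F m i T.X₃)) :
    Function.Injective (F.map m e T.f) := by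
  obtain _ | e := e
  · have := hT.mono_f
    exact F.map_inj_zero T.f
  · exact F.map_inj_of hT (hC e (by omega))

section unb
variable {m : Ideal S} {i : ℕ} {A B C : Type u} [AddCommGroup A] [AddCommGroup B]
    [AddCommGroup C] [Module S A] [Module S B] [Module S C] {f : A →ₗ[S] B} {g : B →ₗ[S] C}

lemma F.inj_of' {h : Function.Exact f g} (hs : (sc f g h).ShortExact)
    (hC : ∀ j < i, Subsingleton (F m j (ModuleCat.of S C))) :
    Function.Injective (F.map m i (ModuleCat.ofHom f)) := F.inj_of hs hC

lemma F.ex2 {h : Function.Exact f g} (hs : (sc f g h).ShortExact) (z : F m i (ModuleCat.of S B))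
    (hz : F.map m i (ModuleCat.ofHom g) z = 0) : ∃ x, F.map m i (ModuleCat.ofHom f) x = z :=
  F.exact₂ hs hz
end unb

end lam
section lam2
variable {S : Type u} [CommRing S] [IsLocalRing S] [IsNoetherianRing S] {D : Type u} [AddCommGroup D] [Module S D]
  {e : ℕ} (hB : Bass S D e)
include hB

lemma D_ss {i : ℕ} (hi : i < e) : Subsingleton (F (maximalIdeal S) i (ModuleCat.of S D)) := by
  refine subsingleton_of_forall_eq 0 fun x => ?_
  obtain ⟨t, x, rfl⟩ := F.exists_of x
  have := ext_lt hB (kil_quot (m := maximalIdeal S) (t := t)) hi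
  rw [Subsingleton.elim x 0, _root_.map_zero]

omit hB in
lemma pres (N : Type u) [AddCommGroup N] [Module S N] [Module.Finite S N]
    (hN : ∀ i, 0 < i → Subsingleton (Ext (ModuleCat.of S N) (ModuleCat.of S D) i)) :
    ∃ b, ∃ g : (Fin b → S) →ₗ[S] N, Function.Surjective g ∧ ∃ h : Function.Exact (LinearMap.lcomp S D g)
      (LinearMap.lcomp S D (LinearMap.ker g).subtype), (sc _ _ h).ShortExact ∧
      ∀ i, 0 < i → Subsingleton (Ext (ModuleCat.of S (LinearMap.ker g)) (ModuleCat.of S D) i) := by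
  obtain ⟨b, g, hg⟩ := Module.Finite.exists_fin' S N
  have hse := sc_exact (LinearMap.exact_subtype_ker_map g) (Submodule.subtype_injective _) hg
  obtain ⟨h, h'⟩ := dual_seq D (LinearMap.exact_subtype_ker_map g) (Submodule.subtype_injective _) hg (hN 1 one_pos)
  refine ⟨b, g, hg, h, h', fun i hi => ?_⟩
  have : Projective (ModuleCat.of S (Fin b → S)) := ModuleCat.projective_of_free (Pi.basisFun S (Fin b))
  exact ext_ss₁ hse _ rfl (ext_proj _ _ i hi) (hN _ (by omega))

lemma dual_ss (i : ℕ) : ∀ (N : Type u) [AddCommGroup N] [Module S N] [Module.Finite S N]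
    (_ : ∀ i, 0 < i → Subsingleton (Ext (ModuleCat.of S N) (ModuleCat.of S D) i)) (_ : i < e),
    Subsingleton (F (maximalIdeal S) i (ModuleCat.of S (N →ₗ[S] D))) := by
  induction i with
  | zero =>
    intro N _ _ _ hN hi
    obtain ⟨b, g, hg, h, h', -⟩ := pres N hN
    have := h'.mono_f
    have h1 := F.map_inj_zero (m := maximalIdeal S) (sc _ _ h).f
    have := free_ss (b := b) (maximalIdeal S) D (D_ss hB hi)
    exact h1.subsingleton
  | succ i ih =>
    intro N _ _ _ hN hi
    obtain ⟨b, g, hg, h, h', hK⟩ := pres N hN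
    exact F.ss₁ h' (ih _ hK (by omega)) (free_ss (maximalIdeal S) D (D_ss hB hi))

lemma lam_inj (N : Type u) [AddCommGroup N] [Module S N] [Module.Finite S N]
    (hN : ∀ i, 0 < i → Subsingleton (Ext (ModuleCat.of S N) (ModuleCat.of S D) i)) :
    Function.Injective (lam (maximalIdeal S) D e N) := by
  obtain ⟨b, g, hg, h, h', hK⟩ := pres N hN
  rw [injective_iff_map_eq_zero]
  intro x hx
  refine F.inj_of' h' (fun i hi => dual_ss hB i _ hK hi) ?_
  rw [_root_.map_zero]
  apply lam_free_inj
  apply LinearMap.ext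
  intro v
  rw [lam_nat, hx]; rfl

lemma lam_surj (N : Type u) [AddCommGroup N] [Module S N] [Module.Finite S N]
    (hN : ∀ i, 0 < i → Subsingleton (Ext (ModuleCat.of S N) (ModuleCat.of S D) i)) :
    Function.Surjective (lam (maximalIdeal S) D e N) := by
  obtain ⟨b, g, hg, h, h', hK⟩ := pres N hN
  intro φ
  obtain ⟨y, hy⟩ := lam_free_surj (maximalIdeal S) D e (φ ∘ₗ g)
  obtain ⟨x, hx⟩ := F.ex2 h' y (by
    apply lam_inj hB _ hK
    rw [_root_.map_zero]
    apply LinearMap.ext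
    intro k
    refine (lam_nat (maximalIdeal S) D e _ y k).trans ?_
    rw [hy]
    exact (congrArg φ k.2).trans (_root_.map_zero φ))
  refine ⟨x, ?_⟩
  apply LinearMap.ext
  intro n
  obtain ⟨v, rfl⟩ := hg n
  rw [← lam_nat]
  refine (congrArg (fun z => lam (maximalIdeal S) D e _ z v) hx).trans ?_
  rw [hy]; rfl

/-- summary of local results -/
lemma local_main (hD : Dz S D) :
    (∀ i < e, Subsingleton (F (maximalIdeal S) i (ModuleCat.of S S))) ∧
    Nonempty (F (maximalIdeal S) e (ModuleCat.of S S) ≃ₗ[S] (D →ₗ[S] F (maximalIdeal S) e (ModuleCat.of S D))) := by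
  have := hD.fin
  let ε : S ≃ₗ[S] (D →ₗ[S] D) := LinearEquiv.ofBijective (LinearMap.toSpanSingleton S _ LinearMap.id) hD.hom
  let i1 : ModuleCat.of S S ≅ ModuleCat.of S (D →ₗ[S] D) := ε.toModuleIso
  refine ⟨fun i hi => F.ss_of_iso i1.symm (dual_ss hB i D hD.ext hi), ⟨?_⟩⟩
  let ε2 : F (maximalIdeal S) e (ModuleCat.of S S) ≃ₗ[S] F (maximalIdeal S) e (ModuleCat.of S (D →ₗ[S] D)) :=
    LinearEquiv.ofLinearMap (F.map (maximalIdeal S) e i1.hom) (F.map (maximalIdeal S) e i1.inv) ?_ ?_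
  exact ε2.trans (LinearEquiv.ofBijective _ ⟨lam_inj hB D hD.ext, lam_surj hB D hD.ext⟩)
  · apply LinearMap.ext
    intro x
    rw [LinearMap.comp_apply, ← F.map_comp, i1.inv_hom_id, F.map_id]; rfl
  · apply LinearMap.ext
    intro x
    rw [LinearMap.comp_apply, ← F.map_comp, i1.hom_inv_id, F.map_id]; rfl

end lam2
end TH
namespace TH
open CategoryTheory Limits Opposite Abelian IsLocalRing
set_option linter.unusedVariables false
section hull
variable {R : Type u} [CommRing R] (p : Ideal R) [p.IsPrime] {H : Type u} [AddCommGroup H] [Module R H]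
  [Module (Localization.AtPrime p) H] [IsScalarTower R (Localization.AtPrime p) H]

lemma h_units (s : p.primeCompl) : IsUnit (algebraMap R (Module.End R H) s) :=
  (isLocalizedModule_id p.primeCompl H (Localization.AtPrime p)).map_units s

noncomputable def homL {X : Type u} [AddCommGroup X] [Module R X] (g : X →ₗ[R] H) :
    LocalizedModule p.primeCompl X →ₗ[Localization.AtPrime p] H :=
  (LocalizedModule.lift p.primeCompl g (h_units p)).extendScalarsOfIsLocalization p.primeCompl _

lemma homL_mk {X : Type u} [AddCommGroup X] [Module R X] (g : X →ₗ[R] H) (x : X) :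
    homL p g (LocalizedModule.mkLinearMap p.primeCompl X x) = g x :=
  LinearMap.congr_fun (LocalizedModule.lift_comp p.primeCompl g (h_units p)) x

lemma homL_ext {X : Type u} [AddCommGroup X] [Module R X]
    {f g : LocalizedModule p.primeCompl X →ₗ[Localization.AtPrime p] H}
    (h : ∀ x, f (LocalizedModule.mkLinearMap p.primeCompl X x) = g (LocalizedModule.mkLinearMap p.primeCompl X x)) :
    f = g := by
  have := IsLocalizedModule.ext p.primeCompl (LocalizedModule.mkLinearMap p.primeCompl X) (h_units p)
    (j := f.restrictScalars R) (k := g.restrictScalars R) (by ext x; exact h x)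
  apply LinearMap.ext
  intro x
  exact LinearMap.congr_fun this x

variable (H) in
noncomputable def homLE (X : Type u) [AddCommGroup X] [Module R X] :
    (LocalizedModule p.primeCompl X →ₗ[Localization.AtPrime p] H) ≃ₗ[R] (X →ₗ[R] H) where
  toFun f := f.restrictScalars R ∘ₗ LocalizedModule.mkLinearMap p.primeCompl X
  map_add' f g := rfl
  map_smul' r f := rfl
  invFun := homL p
  left_inv f := homL_ext p fun x => homL_mk p _ x
  right_inv g := LinearMap.ext fun x => homL_mk p g x

lemma inj_restrict (hH : Module.Injective (Localization.AtPrime p) H) : Module.Injective R H := by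
  refine ⟨fun X Y _ _ _ _ f hf g => ?_⟩
  obtain ⟨φ, hφ⟩ := hH.out (LocalizedModule.map p.primeCompl f)
    (LocalizedModule.map_injective p.primeCompl f hf) (homL p g)
  refine ⟨φ.restrictScalars R ∘ₗ LocalizedModule.mkLinearMap p.primeCompl Y, fun x => ?_⟩
  rw [← homL_mk p g x, ← hφ]
  simp [LocalizedModule.map_mk]

lemma hull_equiv (hH : Module.Injective (Localization.AtPrime p) H) (z : H) (hz : z ≠ 0)
    (hm : ∀ a ∈ maximalIdeal (Localization.AtPrime p), a • z = 0)
    (hs : ∀ w : H, w ≠ 0 → ∃ s : Localization.AtPrime p, s • w = z)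
    (E : Type u) [AddCommGroup E] [Module R E] (hE : IsInjectiveHull R (R ⧸ p) E) : Nonempty (E ≃ₗ[R] H) := by
  obtain ⟨hEi, f, hf, hess⟩ := hE
  have hHi := inj_restrict p hH
  let g : (R ⧸ p) →ₗ[R] H := Submodule.liftQ p (LinearMap.toSpanSingleton R H z) (by
    intro a ha
    rw [LinearMap.mem_ker, LinearMap.toSpanSingleton_apply, ← algebraMap_smul (Localization.AtPrime p) a z]
    apply hm
    rw [← IsLocalization.AtPrime.map_eq_maximalIdeal p]
    exact Ideal.mem_map_of_mem _ ha)
  have hgm : ∀ a : R, g (Submodule.Quotient.mk a) = a • z := fun a => rfl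
  have hunit : ∀ a : R, a ∉ p → a • z ≠ 0 := by
    intro a ha h0
    have hu : IsUnit (algebraMap R (Localization.AtPrime p) a) := IsLocalization.map_units _ (⟨a, ha⟩ : p.primeCompl)
    rw [← algebraMap_smul (Localization.AtPrime p) a z, hu.smul_eq_zero] at h0
    exact hz h0
  have hg : Function.Injective g := by
    rw [injective_iff_map_eq_zero]
    intro y hy
    obtain ⟨a, rfl⟩ := Submodule.Quotient.mk_surjective _ y
    by_contra h
    exact hunit a (fun ha => h ((Submodule.Quotient.mk_eq_zero _).2 ha)) hy
  obtain ⟨φ, hφ⟩ := hHi.out f hf g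
  have hφi : Function.Injective φ := by
    rw [← LinearMap.ker_eq_bot]
    by_contra h
    apply hess _ h
    rw [eq_bot_iff]
    rintro _ ⟨hx, y, rfl⟩
    have : g y = 0 := (hφ y).symm.trans hx
    rw [(injective_iff_map_eq_zero g).1 hg y this, _root_.map_zero]
    exact Submodule.zero_mem _
  obtain ⟨ψ, hψ⟩ := hEi.out φ hφi LinearMap.id
  refine ⟨(LinearEquiv.ofBijective ψ ⟨?_, fun x => ⟨_, hψ x⟩⟩).symm⟩
  rw [injective_iff_map_eq_zero]
  intro w hw
  by_contra hw0
  obtain ⟨s, hs⟩ := hs w hw0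
  obtain ⟨a, b, rfl⟩ := IsLocalization.exists_mk'_eq p.primeCompl s
  have h1 : a • w = (b : R) • z := by
    rw [← hs, ← algebraMap_smul (Localization.AtPrime p) (b : R), smul_smul, ← algebraMap_smul (Localization.AtPrime p) a w]
    congr 1
    rw [IsLocalization.mk'_spec'_mk]
  have h2 : f (Submodule.Quotient.mk (b : R)) = 0 := by
    have h3 : φ (f (Submodule.Quotient.mk (b : R))) = a • w := by rw [hφ, hgm, h1]
    have := hψ (f (Submodule.Quotient.mk (b : R)))
    rw [h3, _root_.map_smul, hw, smul_zero] at this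
    exact this.symm
  have h3 := (injective_iff_map_eq_zero f).1 hf _ h2
  exact b.2 ((Submodule.Quotient.mk_eq_zero p).1 h3)

end hull
section rmod
variable {R : Type u} [CommRing R] (p : Ideal R) [p.IsPrime]

noncomputable instance rF (m : Ideal (Localization.AtPrime p)) (i : ℕ) (X : ModuleCat.{u} (Localization.AtPrime p)) :
    Module R (F m i X) := Module.compHom _ (algebraMap R (Localization.AtPrime p))

instance rF_tower (m : Ideal (Localization.AtPrime p)) (i : ℕ) (X : ModuleCat.{u} (Localization.AtPrime p)) :
    IsScalarTower R (Localization.AtPrime p) (F m i X) := IsScalarTower.of_algebraMap_smul fun _ _ => rfl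

/-- global summary -/
lemma main1 [IsNoetherianRing R] (D : Type u) [AddCommGroup D] [Module R D]
    (hD : IsDualizingModule R D) (Ep : Type u) [AddCommGroup Ep] [Module R Ep]
    (hEp : IsInjectiveHull R (R ⧸ p) Ep) : ∃ e : ℕ, ringKrullDim (Localization.AtPrime p) = e ∧
    (∀ i < e, Subsingleton (F (maximalIdeal (Localization.AtPrime p)) i (ModuleCat.of _ (Localization.AtPrime p)))) ∧
    Nonempty (F (maximalIdeal (Localization.AtPrime p)) e (ModuleCat.of _ (Localization.AtPrime p)) ≃ₗ[R] (D →ₗ[R] Ep)) := by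
  have hDz := dz_loc p D hD
  obtain ⟨e, hB⟩ := bass hDz
  obtain ⟨h1, ⟨ε⟩⟩ := local_main hB hDz
  obtain ⟨z, hz, hm, hs⟩ := socle hB
  obtain ⟨ε'⟩ := hull_equiv p (H_inj hB) z hz hm hs Ep hEp
  refine ⟨e, hB.dim, h1, ⟨?_⟩⟩
  exact (ε.restrictScalars R).trans ((homLE p _ D).trans (LinearEquiv.congrRight ε'.symm))

end rmod
end TH
namespace TH
open CategoryTheory Limits Opposite Abelian IsLocalRing
open scoped TensorProduct
set_option linter.unusedSectionVars false
attribute [local irreducible] F.map F.del F.act F.of instAddCommGroupF instModuleF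
section tau
variable {R : Type u} [CommRing R] (p : Ideal R) [p.IsPrime]

abbrev LMd (M : Type u) [AddCommGroup M] [Module R M] : ModuleCat.{u} (Localization.AtPrime p) :=
  ModuleCat.of (Localization.AtPrime p) (LocalizedModule p.primeCompl M)

abbrev Gm (i : ℕ) (M : Type u) [AddCommGroup M] [Module R M] : Type u :=
  F (maximalIdeal (Localization.AtPrime p)) i (LMd p M)

abbrev Wm (i : ℕ) : Type u :=
  F (maximalIdeal (Localization.AtPrime p)) i (ModuleCat.of (Localization.AtPrime p) (Localization.AtPrime p))

variable {M N : Type u} [AddCommGroup M] [Module R M] [AddCommGroup N] [Module R N]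

noncomputable def lmap (f : M →ₗ[R] N) : LMd p M ⟶ LMd p N := ModuleCat.ofHom (LocalizedModule.map p.primeCompl f)

noncomputable def gmap (i : ℕ) (f : M →ₗ[R] N) : Gm p i M →ₗ[R] Gm p i N :=
  (F.map (maximalIdeal (Localization.AtPrime p)) i (lmap p f)).restrictScalars R

noncomputable def pt (x : M) : ModuleCat.of (Localization.AtPrime p) (Localization.AtPrime p) ⟶ LMd p M :=
  ModuleCat.ofHom (LinearMap.toSpanSingleton (Localization.AtPrime p) _ (LocalizedModule.mkLinearMap p.primeCompl M x))

lemma pt_add (x y : M) : pt p (x + y) = pt p x + pt p y := by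
  unfold pt
  rw [_root_.map_add, LinearMap.toSpanSingleton_add, ModuleCat.ofHom_add]

lemma pt_smul (r : R) (x : M) : pt p (r • x) = algebraMap R (Localization.AtPrime p) r • pt p x := by
  apply ModuleCat.hom_ext
  apply LinearMap.ext
  intro s
  change s • LocalizedModule.mkLinearMap p.primeCompl M (r • x) = algebraMap R (Localization.AtPrime p) r • s • LocalizedModule.mkLinearMap p.primeCompl M x
  rw [_root_.map_smul, algebraMap_smul, smul_comm]

lemma pt_map (f : M →ₗ[R] N) (x : M) : pt p x ≫ lmap p f = pt p (f x) := by
  apply ModuleCat.hom_ext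
  apply LinearMap.ext
  intro s
  change LocalizedModule.map p.primeCompl f (s • LocalizedModule.mkLinearMap p.primeCompl M x) = s • LocalizedModule.mkLinearMap p.primeCompl N (f x)
  rw [_root_.map_smul]
  congr 1
  simp [LocalizedModule.map_mk]

noncomputable def tau (e : ℕ) (M : Type u) [AddCommGroup M] [Module R M] : M ⊗[R] Wm p e →ₗ[R] Gm p e M :=
  TensorProduct.lift
    { toFun := fun x => (F.map (maximalIdeal (Localization.AtPrime p)) e (pt p x)).restrictScalars R
      map_add' := fun x y => by
        apply LinearMap.ext
        intro w
        change F.map _ e (pt p (x + y)) w = F.map _ e (pt p x) w + F.map _ e (pt p y) w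
        rw [pt_add, F.map_add]
      map_smul' := fun r x => by
        apply LinearMap.ext
        intro w
        change F.map _ e (pt p (r • x)) w = r • F.map _ e (pt p x) w
        rw [pt_smul, F.map_smul, algebraMap_smul] }

lemma tau_tmul (e : ℕ) (x : M) (w : Wm p e) : tau p e M (x ⊗ₜ w) = F.map _ e (pt p x) w := rfl

lemma tau_nat (e : ℕ) (f : M →ₗ[R] N) (t : M ⊗[R] Wm p e) :
    tau p e N (f.rTensor _ t) = gmap p e f (tau p e M t) := by
  induction t using TensorProduct.induction_on with
  | zero => simp only [_root_.map_zero]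
  | add x y hx hy => simp only [_root_.map_add, hx, hy]
  | tmul x w =>
    rw [LinearMap.rTensor_tmul, tau_tmul, tau_tmul, ← pt_map, F.map_comp]
    rfl

variable {ι : Type u}

noncomputable def crd (i : ι) : LMd p (ι →₀ R) ⟶ ModuleCat.of (Localization.AtPrime p) (Localization.AtPrime p) :=
  ModuleCat.ofHom (homL p (Algebra.linearMap R (Localization.AtPrime p) ∘ₗ Finsupp.lapply i))

lemma pt_crd (v : ι →₀ R) (i : ι) : pt p v ≫ crd p i = algebraMap R (Localization.AtPrime p) (v i) • 𝟙 _ := by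
  apply ModuleCat.hom_ext
  apply LinearMap.ext
  intro s
  refine (LinearMap.map_smul (homL p (Algebra.linearMap R (Localization.AtPrime p) ∘ₗ Finsupp.lapply i)) s _).trans ?_
  rw [homL_mk]
  change s * _ = _ * s
  rw [mul_comm]
  rfl

noncomputable def Qd (J : Finset ι) : LMd p (ι →₀ R) ⟶ LMd p (ι →₀ R) :=
  ∑ j ∈ J, crd p j ≫ pt p (Finsupp.single j (1:R))

lemma Qd_mk (J : Finset ι) (v : ι →₀ R) (h : v.support ⊆ J) :
    (Qd p J).hom (LocalizedModule.mkLinearMap p.primeCompl _ v) = LocalizedModule.mkLinearMap p.primeCompl _ v := by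
  have h1 : (Qd p J).hom (LocalizedModule.mkLinearMap p.primeCompl _ v) =
      ∑ j ∈ J, LocalizedModule.mkLinearMap p.primeCompl _ (v j • Finsupp.single j (1:R)) := by
    unfold Qd
    rw [ModuleCat.hom_sum, LinearMap.sum_apply]
    refine Finset.sum_congr rfl fun j _ => ?_
    change (homL p (Algebra.linearMap R (Localization.AtPrime p) ∘ₗ Finsupp.lapply j) _ : Localization.AtPrime p) • LocalizedModule.mkLinearMap p.primeCompl _ (Finsupp.single j (1:R)) = _
    rw [homL_mk, _root_.map_smul]
    exact algebraMap_smul (Localization.AtPrime p) (v j) (LocalizedModule.mkLinearMap p.primeCompl _ (Finsupp.single j (1:R)))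
  rw [h1, ← _root_.map_sum]
  congr 1
  conv_rhs => rw [← Finsupp.sum_single v]
  simp only [Finsupp.smul_single, smul_eq_mul, mul_one]
  exact (Finsupp.sum_of_support_subset v h _ (by simp)).symm

lemma Qd_fix (x : LMd p (ι →₀ R)) : ∃ I : Finset ι, ∀ J, I ⊆ J → (Qd p J).hom x = x := by
  obtain ⟨⟨v, s⟩, h⟩ := IsLocalizedModule.surj p.primeCompl (LocalizedModule.mkLinearMap p.primeCompl (ι →₀ R)) x
  refine ⟨v.support, fun J hJ => ?_⟩
  apply loc_smul_cancel p.primeCompl s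
  change s • x = _ at h
  rw [h, ← Qd_mk p J v hJ, ← h]
  have : ∀ y : LocalizedModule p.primeCompl (ι →₀ R), s • y = algebraMap R (Localization.AtPrime p) s • y := by
    intro y; rw [algebraMap_smul]; rfl
  rw [this, this]
  exact (LinearMap.map_smul (Qd p J).hom _ x).symm

lemma free_decomp {i : ℕ} (z : Gm p i (ι →₀ R)) [IsNoetherianRing R] : ∃ J : Finset ι,
    z = ∑ j ∈ J, F.map _ i (pt p (Finsupp.single j (1:R))) (F.map _ i (crd p j) z) := by
  classical
  obtain ⟨X, ⟨T, rfl⟩, w, hw⟩ := F.fg z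
  choose I hI using Qd_fix p (ι := ι)
  let J := T.biUnion I
  refine ⟨J, ?_⟩
  have h1 : ModuleCat.ofHom (Submodule.span (Localization.AtPrime p) (T : Set (LMd p (ι →₀ R)))).subtype ≫ Qd p J =
      ModuleCat.ofHom (Submodule.span (Localization.AtPrime p) (T : Set (LMd p (ι →₀ R)))).subtype := by
    apply ModuleCat.hom_ext
    apply LinearMap.ext
    intro x
    change (Qd p J).hom x.1 = x.1
    have h2 : Submodule.span (Localization.AtPrime p) (T : Set (LMd p (ι →₀ R))) ≤ LinearMap.eqLocus (Qd p J).hom LinearMap.id := by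
      rw [Submodule.span_le]
      intro y hy
      exact hI y J (Finset.subset_biUnion_of_mem I hy)
    exact h2 x.2
  have h3 : F.map _ i (Qd p J) z = z := by
    rw [← hw, ← F.map_comp, h1]
  refine h3.symm.trans ?_
  unfold Qd
  rw [F.map_sum]
  exact Finset.sum_congr rfl fun j _ => F.map_comp _ _ _

lemma crd_tau [DecidableEq ι] (e : ℕ) (t : (ι →₀ R) ⊗[R] Wm p e) (i : ι) :
    F.map _ e (crd p i) (tau p e _ t) = TensorProduct.finsuppScalarLeft R (Wm p e) ι t i := by
  induction t using TensorProduct.induction_on with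
  | zero => simp only [_root_.map_zero, Finsupp.zero_apply]
  | add x y hx hy => simp only [_root_.map_add, Finsupp.add_apply, hx, hy]
  | tmul x w =>
    rw [tau_tmul, ← F.map_comp, pt_crd, F.map_smul, F.map_id, TensorProduct.finsuppScalarLeft_apply_tmul_apply, algebraMap_smul]

lemma free_van [IsNoetherianRing R] {i : ℕ} (h : Subsingleton (Wm p i)) : Subsingleton (Gm p i (ι →₀ R)) := by
  refine subsingleton_of_forall_eq 0 fun z => ?_
  obtain ⟨J, hJ⟩ := free_decomp p z
  rw [hJ]
  refine Finset.sum_eq_zero fun j _ => ?_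
  rw [Subsingleton.elim (F.map _ i (crd p j) z) 0, _root_.map_zero]

lemma tau_free [IsNoetherianRing R] (e : ℕ) : Function.Bijective (tau p e (ι →₀ R)) := by
  classical
  constructor
  · rw [injective_iff_map_eq_zero]
    intro t ht
    apply (TensorProduct.finsuppScalarLeft R (Wm p e) ι).injective
    ext i
    rw [← crd_tau, ht, _root_.map_zero, _root_.map_zero]
    rfl
  · intro z
    obtain ⟨J, hJ⟩ := free_decomp p z
    refine ⟨∑ j ∈ J, (Finsupp.single j (1:R)) ⊗ₜ (F.map _ e (crd p j) z), ?_⟩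
    rw [_root_.map_sum]
    exact hJ.symm

variable {K P : Type u} [AddCommGroup K] [Module R K] [AddCommGroup P] [Module R P]
  {f : K →ₗ[R] P} {g : P →ₗ[R] M}

lemma lsc (h : Function.Exact f g) (hf : Function.Injective f) (hg : Function.Surjective g) :
    (sc (LocalizedModule.map p.primeCompl f) (LocalizedModule.map p.primeCompl g) (loc_exact p.primeCompl h)).ShortExact :=
  sc_exact (loc_exact p.primeCompl h)
      (LocalizedModule.map_injective p.primeCompl _ hf)
      (LocalizedModule.map_surjective p.primeCompl g hg)

lemma gmap_surj [IsNoetherianRing R] (h : Function.Exact f g) (hf : Function.Injective f) (hg : Function.Surjective g)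
    {e : ℕ} (he : ringKrullDim (Localization.AtPrime p) = e) : Function.Surjective (gmap p e g) :=
  F.map_surj_of (lsc p h hf hg) (F.groth he _ (Nat.lt_succ_self e))

lemma gmap_ex2 (h : Function.Exact f g) (hf : Function.Injective f) (hg : Function.Surjective g)
    {i : ℕ} (z : Gm p i P) (hz : gmap p i g z = 0) : ∃ x, gmap p i f x = z :=
  F.ex2 (lsc p h hf hg) z hz

lemma exists_pres (M : Type u) [AddCommGroup M] [Module R M] : ∃ (K : Type u) (_ : AddCommGroup K) (_ : Module R K)
    (f : K →ₗ[R] (M →₀ R)) (g : (M →₀ R) →ₗ[R] M), Function.Exact f g ∧ Function.Injective f ∧ Function.Surjective g := by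
  let g : (M →₀ R) →ₗ[R] M := Finsupp.linearCombination R id
  exact ⟨LinearMap.ker g, inferInstance, inferInstance, (LinearMap.ker g).subtype, g,
    g.exact_subtype_ker_map, Submodule.injective_subtype _, Finsupp.linearCombination_id_surjective R M⟩

lemma tau_surj [IsNoetherianRing R] {e : ℕ} (he : ringKrullDim (Localization.AtPrime p) = e)
    (M : Type u) [AddCommGroup M] [Module R M] : Function.Surjective (tau p e M) := by
  obtain ⟨K, _, _, f, g, h, hf, hg⟩ := exists_pres (R := R) M
  intro z
  obtain ⟨y, rfl⟩ := gmap_surj p h hf hg he z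
  obtain ⟨t, rfl⟩ := (tau_free p e).2 y
  exact ⟨_, tau_nat p e g t⟩

lemma tau_bij [IsNoetherianRing R] {e : ℕ} (he : ringKrullDim (Localization.AtPrime p) = e)
    (M : Type u) [AddCommGroup M] [Module R M] : Function.Bijective (tau p e M) := by
  refine ⟨?_, tau_surj p he M⟩
  obtain ⟨K, _, _, f, g, h, hf, hg⟩ := exists_pres (R := R) M
  rw [injective_iff_map_eq_zero]
  intro t ht
  obtain ⟨y, rfl⟩ := LinearMap.rTensor_surjective (Wm p e) hg t
  rw [tau_nat] at ht
  obtain ⟨x, hx⟩ := gmap_ex2 p h hf hg _ ht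
  obtain ⟨k, rfl⟩ := tau_surj p he K x
  rw [← tau_nat] at hx
  rw [← (tau_free p e).1 hx, ← LinearMap.comp_apply, ← LinearMap.rTensor_comp, h.linearMap_comp_eq_zero,
    LinearMap.rTensor_zero, LinearMap.zero_apply]

end tau
end TH
namespace TH
open CategoryTheory Limits Opposite Abelian IsLocalRing MonoidalCategory
open scoped TensorProduct
section tor
variable {R : Type u} [CommRing R] {W : ModuleCat.{u} R} (Q : ProjectiveResolution W)

noncomputable def tC (X : ModuleCat.{u} R) : ChainComplex (ModuleCat.{u} R) ℕ :=
  (((tensoringLeft (ModuleCat.{u} R)).obj X).mapHomologicalComplex _).obj Q.complex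

noncomputable def tCm {X Y : ModuleCat.{u} R} (f : X ⟶ Y) : tC Q X ⟶ tC Q Y :=
  (NatTrans.mapHomologicalComplex ((tensoringLeft (ModuleCat.{u} R)).map f) _).app Q.complex

noncomputable def tS (T : ShortComplex (ModuleCat.{u} R)) : ShortComplex (ChainComplex (ModuleCat.{u} R) ℕ) :=
  ShortComplex.mk (tCm Q T.f) (tCm Q T.g) (by
    apply HomologicalComplex.hom_ext
    intro n
    change T.f ▷ Q.complex.X n ≫ T.g ▷ Q.complex.X n = 0
    rw [← comp_whiskerRight, T.zero, MonoidalPreadditive.zero_whiskerRight])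

instance flatQ (n : ℕ) : Module.Flat R (Q.complex.X n) := by
  have := (IsProjective.iff_projective (Q.complex.X n)).2 (Q.projective n)
  infer_instance

lemma tS_exact {T : ShortComplex (ModuleCat.{u} R)} (hT : T.ShortExact) : (tS Q T).ShortExact := by
  apply HomologicalComplex.shortExact_of_degreewise_shortExact
  intro n
  exact hT.map_of_exact (tensorRight (Q.complex.X n))

lemma tC_flat (X : ModuleCat.{u} R) [Module.Flat R X] (n : ℕ) : IsZero ((tC Q X).homology (n+1)) := by
  rw [← HomologicalComplex.exactAt_iff_isZero_homology]
  have h := Q.complex_exactAt_succ n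
  exact ShortComplex.Exact.map h (tensorLeft X)

noncomputable def torIso (X : ModuleCat.{u} R) (n : ℕ) : ((Tor (ModuleCat.{u} R) n).obj X).obj W ≅ (tC Q X).homology n :=
  Q.isoLeftDerivedObj _ n

noncomputable def tZ (X : ModuleCat.{u} R) : (tC Q X).homology 0 ≅ X ⊗ W :=
  (torIso Q X 0).symm ≪≫ (Functor.leftDerivedZeroIsoSelf ((tensoringLeft (ModuleCat.{u} R)).obj X)).app W

noncomputable def z0 (X : ModuleCat.{u} R) : (tC Q X).opcycles 0 ⟶ X ⊗ W :=
  Q.fromLeftDerivedZero' ((tensoringLeft (ModuleCat.{u} R)).obj X)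

noncomputable def pi0 : Q.complex.X 0 ⟶ W := Q.π.f 0

lemma p_z0 (X : ModuleCat.{u} R) : (tC Q X).pOpcycles 0 ≫ z0 Q X = X ◁ pi0 Q :=
  Q.pOpcycles_comp_fromLeftDerivedZero' ((tensoringLeft (ModuleCat.{u} R)).obj X)

lemma tZ_hom (X : ModuleCat.{u} R) : (tZ Q X).hom = (tC Q X).homologyι 0 ≫ z0 Q X := by
  unfold tZ torIso
  refine (Iso.inv_comp_eq _).2 ?_
  exact Q.fromLeftDerivedZero_eq _

lemma z0_nat {X Y : ModuleCat.{u} R} (f : X ⟶ Y) :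
    HomologicalComplex.opcyclesMap (tCm Q f) 0 ≫ z0 Q Y = z0 Q X ≫ f ▷ W := by
  rw [← cancel_epi (HomologicalComplex.pOpcycles _ _), HomologicalComplex.p_opcyclesMap_assoc, p_z0, ← Category.assoc, p_z0]
  exact (whisker_exchange f (pi0 Q)).symm

lemma tZ_nat {X Y : ModuleCat.{u} R} (f : X ⟶ Y) :
    HomologicalComplex.homologyMap (tCm Q f) 0 ≫ (tZ Q Y).hom = (tZ Q X).hom ≫ f ▷ W := by
  rw [tZ_hom, tZ_hom, HomologicalComplex.homologyι_naturality_assoc, Category.assoc, z0_nat]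

end tor

section tor2
variable {R : Type u} [CommRing R] (W : Type u) [AddCommGroup W] [Module R W]

noncomputable abbrev TorM (k : ℕ) (M W : Type u) [AddCommGroup M] [Module R M] [AddCommGroup W] [Module R W] : ModuleCat.{u} R :=
  ((Tor (ModuleCat.{u} R) k).obj (ModuleCat.of R M)).obj (ModuleCat.of R W)

lemma tor_zero (M : Type u) [AddCommGroup M] [Module R M] : Nonempty (TorM (R := R) 0 M W ≃ₗ[R] M ⊗[R] W) :=
  ⟨Iso.toLinearEquiv ((Functor.leftDerivedZeroIsoSelf ((tensoringLeft (ModuleCat.{u} R)).obj (ModuleCat.of R M))).app (ModuleCat.of R W))⟩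

variable {K P M : Type u} [AddCommGroup K] [Module R K] [AddCommGroup P] [Module R P] [AddCommGroup M] [Module R M]
  {f : K →ₗ[R] P} {g : P →ₗ[R] M} [Module.Flat R P]

lemma tor_succ (h : Function.Exact f g) (hf : Function.Injective f) (hg : Function.Surjective g) (k : ℕ) :
    Nonempty (TorM (R := R) (k+2) M W ≃ₗ[R] TorM (R := R) (k+1) K W) := by
  let Q := projectiveResolution (ModuleCat.of R W)
  have hT := tS_exact Q (sc_exact h hf hg)
  have : Module.Flat R (sc f g h).X₂ := ‹Module.Flat R P›
  have i1 := hT.δIso (k+2) (k+1) rfl (tC_flat Q _ _) (tC_flat Q _ _)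
  exact ⟨(torIso Q _ _ ≪≫ i1 ≪≫ (torIso Q _ _).symm).toLinearEquiv⟩

lemma tor_one (h : Function.Exact f g) (hf : Function.Injective f) (hg : Function.Surjective g) :
    Nonempty (TorM (R := R) 1 M W ≃ₗ[R] LinearMap.ker (f.rTensor W)) := by
  let Q := projectiveResolution (ModuleCat.of R W)
  have hT := tS_exact Q (sc_exact h hf hg)
  have : Module.Flat R (sc f g h).X₂ := ‹Module.Flat R P›
  have i1 : Mono (hT.δ 1 0 rfl) := hT.mono_δ 1 0 rfl (tC_flat Q _ _)
  have i2 := hT.homology_exact₁ 1 0 rfl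
  rw [ShortComplex.moduleCat_exact_iff] at i2
  rw [ModuleCat.mono_iff_injective] at i1
  let φ : TorM (R := R) 1 M W ⟶ ModuleCat.of R (K ⊗[R] W) := (torIso Q _ _).hom ≫ hT.δ 1 0 rfl ≫ (tZ Q (ModuleCat.of R K)).hom
  have hφ : Function.Injective φ.hom := by
    change Function.Injective (fun x => (tZ Q (ModuleCat.of R K)).hom.hom ((hT.δ 1 0 rfl).hom ((torIso Q _ _).hom.hom x)))
    exact ((tZ Q (ModuleCat.of R K)).toLinearEquiv.injective.comp i1).comp (torIso Q (ModuleCat.of R M) 1).toLinearEquiv.injective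
  have key : ∀ y, (f.rTensor W) ((tZ Q (ModuleCat.of R K)).hom.hom y) =
      (tZ Q (ModuleCat.of R P)).hom.hom ((HomologicalComplex.homologyMap (tCm Q (ModuleCat.ofHom f)) 0).hom y) := by
    intro y
    exact (LinearMap.congr_fun (congrArg ModuleCat.Hom.hom (tZ_nat Q (ModuleCat.ofHom f))) y).symm
  have hr : LinearMap.range φ.hom = LinearMap.ker (f.rTensor W) := by
    apply le_antisymm
    · rintro _ ⟨x, rfl⟩
      rw [LinearMap.mem_ker]
      refine (key _).trans ?_
      have := LinearMap.congr_fun (congrArg ModuleCat.Hom.hom (hT.δ_comp 1 0 rfl)) ((torIso Q _ _).hom.hom x)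
      exact (congrArg (tZ Q (ModuleCat.of R P)).hom.hom this).trans (_root_.map_zero _)
    · intro x hx
      obtain ⟨y, rfl⟩ := (tZ Q (ModuleCat.of R K)).toLinearEquiv.surjective x
      have h1 := (key y).symm.trans hx
      have h2 := (injective_iff_map_eq_zero (tZ Q (ModuleCat.of R P)).toLinearEquiv).1 (tZ Q (ModuleCat.of R P)).toLinearEquiv.injective _ h1
      obtain ⟨w, hw⟩ := i2 y h2
      obtain ⟨v, rfl⟩ := (torIso Q (ModuleCat.of R M) 1).toLinearEquiv.surjective w
      exact ⟨v, congrArg (tZ Q (ModuleCat.of R K)).hom.hom hw⟩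
  exact ⟨(LinearEquiv.ofInjective φ.hom hφ).trans (LinearEquiv.ofEq _ _ hr)⟩

end tor2
end TH
namespace TH
open CategoryTheory Limits Opposite Abelian IsLocalRing
open scoped TensorProduct
set_option linter.unusedSectionVars false
attribute [local irreducible] F.map F.del F.act F.of instAddCommGroupF instModuleF
section fin
variable {R : Type u} [CommRing R] (p : Ideal R) [p.IsPrime]
variable {M K P : Type u} [AddCommGroup M] [Module R M] [AddCommGroup K] [Module R K] [AddCommGroup P] [Module R P]
  {f : K →ₗ[R] P} {g : P →ₗ[R] M}

noncomputable def gdel (h : Function.Exact f g) (hf : Function.Injective f) (hg : Function.Surjective g) (i : ℕ) :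
    Gm p i M →ₗ[R] Gm p (i+1) K :=
  (F.del (maximalIdeal (Localization.AtPrime p)) (lsc p h hf hg) i).restrictScalars R

lemma gdel_inj (h : Function.Exact f g) (hf : Function.Injective f) (hg : Function.Surjective g) {i : ℕ}
    (hP : Subsingleton (Gm p i P)) : Function.Injective (gdel p h hf hg i) :=
  F.del_inj_of (lsc p h hf hg) hP

lemma gdel_surj (h : Function.Exact f g) (hf : Function.Injective f) (hg : Function.Surjective g) {i : ℕ}
    (hP : Subsingleton (Gm p (i+1) P)) : Function.Surjective (gdel p h hf hg i) :=
  F.del_surj_of (lsc p h hf hg) hP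

lemma gmap_gdel (h : Function.Exact f g) (hf : Function.Injective f) (hg : Function.Surjective g) {i : ℕ}
    (z : Gm p i M) : gmap p (i+1) f (gdel p h hf hg i z) = 0 :=
  F.exact₁' (lsc p h hf hg) z

lemma gdel_ex (h : Function.Exact f g) (hf : Function.Injective f) (hg : Function.Surjective g) {i : ℕ}
    (z : Gm p (i+1) K) (hz : gmap p (i+1) f z = 0) : ∃ y, gdel p h hf hg i y = z :=
  F.exact₁ (lsc p h hf hg) hz

lemma gmap_inj_zero (hf : Function.Injective f) : Function.Injective (gmap p 0 f) := by
  have : Mono (lmap p f) := (ModuleCat.mono_iff_injective _).2 (LocalizedModule.map_injective p.primeCompl _ hf)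
  exact F.map_inj_zero (lmap p f)

lemma ker_equiv [IsNoetherianRing R] {e : ℕ} (he : ringKrullDim (Localization.AtPrime p) = e) :
    Nonempty (LinearMap.ker (f.rTensor (Wm p e)) ≃ₗ[R] LinearMap.ker (gmap p e f)) := by
  let t := LinearEquiv.ofBijective _ (tau_bij p he K)
  refine ⟨(t.submoduleMap _).trans (LinearEquiv.ofEq _ _ ?_)⟩
  ext x
  obtain ⟨y, rfl⟩ := t.surjective x
  have h1 : f.rTensor (Wm p e) y = 0 ↔ gmap p e f (t y) = 0 := by
    rw [← (injective_iff_map_eq_zero' _).1 (tau_bij p he P).1, tau_nat]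
    rfl
  rw [LinearMap.mem_ker, ← h1]
  constructor
  · rintro ⟨z, hz, hzy⟩
    rw [← t.injective hzy]
    exact hz
  · intro h
    exact ⟨y, h, rfl⟩

lemma main2 [IsNoetherianRing R] {e : ℕ} (he : ringKrullDim (Localization.AtPrime p) = e)
    (hv : ∀ i < e, Subsingleton (Wm p i)) (k : ℕ) : ∀ (M : Type u) [AddCommGroup M] [Module R M],
    (k ≤ e → Nonempty (TorM (R := R) k M (Wm p e) ≃ₗ[R] Gm p (e - k) M)) ∧
    (e < k → Subsingleton (TorM (R := R) k M (Wm p e))) := by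
  induction k with
  | zero =>
    intro M _ _
    refine ⟨fun _ => ?_, fun h => absurd h (Nat.not_lt_zero _)⟩
    obtain ⟨ε⟩ := tor_zero (R := R) (Wm p e) M
    exact ⟨ε.trans (LinearEquiv.ofBijective _ (tau_bij p he M))⟩
  | succ k ih =>
    intro M _ _
    obtain ⟨K, _, _, f, g, h, hf, hg⟩ := exists_pres (R := R) M
    cases k with
    | zero =>
      obtain ⟨ε⟩ := tor_one (R := R) (Wm p e) h hf hg
      obtain ⟨ε'⟩ := ker_equiv p he (f := f)
      constructor
      · intro h1
        obtain ⟨d, rfl⟩ := Nat.exists_eq_add_of_le' h1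
        rw [Nat.add_sub_cancel]
        suffices Nonempty (Gm p d M ≃ₗ[R] LinearMap.ker (gmap p (d+1) f)) by
          obtain ⟨ε''⟩ := this
          exact ⟨ε.trans (ε'.trans ε''.symm)⟩
        have hi := gdel_inj p h hf hg (free_van p (hv d (Nat.lt_succ_self d)))
        refine ⟨(LinearEquiv.ofInjective _ hi).trans (LinearEquiv.ofEq _ _ ?_)⟩
        apply le_antisymm
        · rintro _ ⟨z, rfl⟩
          exact gmap_gdel p h hf hg z
        · intro z hz
          exact gdel_ex p h hf hg z hz
      · intro h1
        obtain rfl : e = 0 := by omega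
        refine (ε.trans ε').toEquiv.subsingleton_congr.2 ?_
        rw [LinearMap.ker_eq_bot.2 (gmap_inj_zero p hf)]
        infer_instance
    | succ k =>
      obtain ⟨ε⟩ := tor_succ (R := R) (Wm p e) h hf hg k
      constructor
      · intro h1
        obtain ⟨d, rfl⟩ := Nat.exists_eq_add_of_le' h1
        obtain ⟨ε'⟩ := (ih K).1 (by omega)
        have e1 : d + (k + 1 + 1) - (k + 1) = d + 1 := by omega
        rw [e1] at ε'
        rw [Nat.add_sub_cancel]
        have hi := gdel_inj p h hf hg (free_van p (hv d (by omega)))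
        have hs := gdel_surj p h hf hg (free_van p (hv (d+1) (by omega)))
        exact ⟨ε.trans (ε'.trans (LinearEquiv.ofBijective _ ⟨hi, hs⟩).symm)⟩
      · intro h1
        refine ε.toEquiv.subsingleton_congr.2 ?_
        rcases Nat.lt_or_ge e (k+1) with h2 | h2
        · exact (ih K).2 h2
        · obtain rfl : e = k + 1 := by omega
          obtain ⟨ε'⟩ := (ih K).1 le_rfl
          rw [Nat.sub_self] at ε'
          refine ε'.toEquiv.subsingleton_congr.2 ?_
          have := free_van p (ι := M) (hv 0 (by omega))
          exact (gmap_inj_zero p hf).subsingleton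

lemma tor_congr (k : ℕ) (M : Type u) [AddCommGroup M] [Module R M] {W W' : Type u} [AddCommGroup W] [Module R W]
    [AddCommGroup W'] [Module R W'] (ε : W ≃ₗ[R] W') : Nonempty (TorM (R := R) k M W ≅ TorM (R := R) k M W') :=
  ⟨((Tor (ModuleCat.{u} R) k).obj (ModuleCat.of R M)).mapIso ε.toModuleIso⟩

lemma main3 [IsNoetherianRing R]
    (D : Type u) [AddCommGroup D] [Module R D] (hD : IsDualizingModule R D)
    (hp : p.IsPrime) (h : ℕ) (hph : idealHeight p hp = (h : ℕ∞))
    (Ep : Type u) [AddCommGroup Ep] [Module R Ep]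
    (hEp : IsInjectiveHull R (R ⧸ p) Ep)
    (M : Type u) [AddCommGroup M] [Module R M] (k : ℕ) :
    (k ≤ h → Nonempty (TorM (R := R) k M (D →ₗ[R] Ep) ≅
        (ModuleCat.restrictScalars (algebraMap R (Localization.AtPrime p))).obj
          ((localCohomology (Ideal.map (algebraMap R (Localization.AtPrime p)) p) (h - k)).obj
            (LMd p M)))) ∧
    (h < k → Limits.IsZero (TorM (R := R) k M (D →ₗ[R] Ep))) := by
  obtain ⟨e, he, hv, ⟨ε⟩⟩ := main1 p D hD Ep hEp
  have heh : e = h := by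
    have h1 := IsLocalization.AtPrime.ringKrullDim_eq_height p (Localization.AtPrime p)
    rw [he, (PrimeSpectrum.height_eq_orderHeight ⟨p, hp⟩ : p.height = _).trans hph] at h1
    exact_mod_cast h1
  subst heh
  obtain ⟨i1⟩ := tor_congr (R := R) k M ε
  obtain ⟨h1, h2⟩ := main2 p he hv k M
  constructor
  · intro hk
    obtain ⟨j⟩ := h1 hk
    rw [IsLocalization.AtPrime.map_eq_maximalIdeal p]
    let j' : TorM (R := R) k M (Wm p e) ≅ (ModuleCat.restrictScalars (algebraMap R (Localization.AtPrime p))).obj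
      (ModuleCat.of (Localization.AtPrime p) (Gm p (e - k) M)) := j.toModuleIso
    exact ⟨i1.symm ≪≫ j' ≪≫ (ModuleCat.restrictScalars (algebraMap R (Localization.AtPrime p))).mapIso (lcIso _ _ _).symm⟩
  · intro hk
    refine IsZero.of_iso ?_ i1.symm
    have := h2 hk
    exact ModuleCat.isZero_of_subsingleton _

end fin
end TH
/-- `Tor_k^R(M, Hom_R(D, E(R/p))) ≅ H^{h-k}_{pR_p}(M_p)`, the isomorphism
being one of `R`-modules (the local cohomology of the localized module is regarded as an
`R`-module by restriction of scalars); for `k > h` the Tor module vanishes. -/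
theorem tor_hom_dualizing_injectiveHull_iso_localCohomology
    {R : Type u} [CommRing R] [IsNoetherianRing R]
    (D : Type u) [AddCommGroup D] [Module R D] (hD : IsDualizingModule R D)
    (p : Ideal R) [hp : p.IsPrime] (h : ℕ) (hph : idealHeight p hp = (h : ℕ∞))
    (Ep : Type u) [AddCommGroup Ep] [Module R Ep]
    (hEp : IsInjectiveHull R (R ⧸ p) Ep)
    (M : Type u) [AddCommGroup M] [Module R M] (k : ℕ) :
    (k ≤ h → Nonempty (
      ((Tor (ModuleCat.{u} R) k).obj (ModuleCat.of R M)).obj (ModuleCat.of R (D →ₗ[R] Ep)) ≅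
        (ModuleCat.restrictScalars (algebraMap R (Localization.AtPrime p))).obj
          ((localCohomology (Ideal.map (algebraMap R (Localization.AtPrime p)) p) (h - k)).obj
            (ModuleCat.of (Localization.AtPrime p)
              (LocalizedModule p.primeCompl M))))) ∧
    (h < k → Limits.IsZero
      (((Tor (ModuleCat.{u} R) k).obj (ModuleCat.of R M)).obj
        (ModuleCat.of R (D →ₗ[R] Ep)))) := by
  exact TH.main3 p D hD hp h hph Ep hEp M k
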